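/- arXiv:2301.04683 — 10 statements merged into one kernel-verified Lean document; each statement's English description precedes it below -/
import Mathlib

section
/- For every real number α with (1+√5)/2 ≤ α < 2, h(α) = 7: there exists a 7-element subset X of L(α) in strictly convex position with conv(X) ∩ L(α) = X, and every finite subset of L(α) in strictly convex position whose convex hull meets L(α) only in that subset has at most 7 elements. -/
/-- The exponential lattice `L(α) = {α^n : n ∈ ℕ₀}²`. -/
def expLattice (α : ℝ) : Set (ℝ × ℝ) :=
  {p | ∃ m n : ℕ, p = (α ^ m, α ^ n)}

/-- A set of points in the plane is in strictly convex position if no point of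
the set lies in the convex hull of the other points. -/
def StrictConvexPos (X : Set (ℝ × ℝ)) : Prop :=
  ∀ x ∈ X, x ∉ convexHull ℝ (X \ {x})

/-- `X` is the vertex set of an empty convex polygon in `S`. -/
def IsEmptyPolygonIn (S X : Set (ℝ × ℝ)) : Prop :=
  X ⊆ S ∧ StrictConvexPos X ∧ convexHull ℝ X ∩ S = X

/-- Every triangle of lattice points with exponents in `E` contains no lattice points other than
its vertices. -/
def EmptyTriangles (α : ℝ) (E : Set (ℕ × ℕ)) : Prop :=
  ∀ p ∈ E, ∀ q ∈ E, ∀ r ∈ E, ∀ z : ℕ × ℕ, ∀ a b c : ℝ, 0 ≤ a → 0 ≤ b → 0 ≤ c → a + b + c = 1 →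
    a * α ^ p.1 + b * α ^ q.1 + c * α ^ r.1 = α ^ z.1 →
    a * α ^ p.2 + b * α ^ q.2 + c * α ^ r.2 = α ^ z.2 → z = p ∨ z = q ∨ z = r

theorem EmptyTriangles.swap {α : ℝ} {E : Set (ℕ × ℕ)} (h : EmptyTriangles α E) :
    EmptyTriangles α (Prod.swap ⁻¹' E) := by
  intro p hp q hq r hr z a b c ha hb hc habc h1 h2
  have := h p.swap hp q.swap hq r.swap hr z.swap a b c ha hb hc habc h2 h1
  simpa only [Prod.swap_inj] using this

/-- A point on the vertical line through `(x₂, y₂)`, between that point and the segment from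
`(x₁, y₁)` to `(x₃, y₃)`, is a convex combination of the three points. -/
theorem exists_weights_of_vertical_between {x₁ x₂ x₃ y₁ y₂ y₃ y : ℝ}
    (h₁₂ : x₁ ≤ x₂) (h₂₃ : x₂ ≤ x₃) (h₁₃ : x₁ < x₃)
    (h : y₂ ≤ y ∧ (x₃ - x₁) * y ≤ y₁ * (x₃ - x₂) + y₃ * (x₂ - x₁) ∨
      y ≤ y₂ ∧ y₁ * (x₃ - x₂) + y₃ * (x₂ - x₁) ≤ (x₃ - x₁) * y) :
    ∃ a b c : ℝ, 0 ≤ a ∧ 0 ≤ b ∧ 0 ≤ c ∧ a + b + c = 1 ∧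
      a * x₁ + b * x₂ + c * x₃ = x₂ ∧ a * y₁ + b * y₂ + c * y₃ = y := by
  have hd : 0 < x₃ - x₁ := sub_pos.2 h₁₃
  obtain ⟨w, hw⟩ : ∃ w, w = (y₁ * (x₃ - x₂) + y₃ * (x₂ - x₁)) / (x₃ - x₁) := ⟨_, rfl⟩
  have hw' : y₁ * (x₃ - x₂) + y₃ * (x₂ - x₁) = (x₃ - x₁) * w := by rw [hw]; field_simp
  have hy : y ∈ segment ℝ y₂ w := by
    rw [segment_eq_uIcc, Set.mem_uIcc]
    rw [hw'] at h
    rcases h with ⟨h, h'⟩ | ⟨h, h'⟩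
    · exact Or.inl ⟨h, le_of_mul_le_mul_left h' hd⟩
    · exact Or.inr ⟨le_of_mul_le_mul_left h' hd, h⟩
  obtain ⟨b, μ, hb, hμ, hbμ, rfl⟩ := hy
  refine ⟨μ * ((x₃ - x₂) / (x₃ - x₁)), b, μ * ((x₂ - x₁) / (x₃ - x₁)),
    mul_nonneg hμ (div_nonneg (sub_nonneg.2 h₂₃) hd.le), hb,
    mul_nonneg hμ (div_nonneg (sub_nonneg.2 h₁₂) hd.le), ?_, ?_, ?_⟩
  · rw [← hbμ]; field_simp; ring
  · obtain rfl : b = 1 - μ := by linarith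
    field_simp; ring
  · rw [hw]; simp only [smul_eq_mul]; field_simp; ring

section UpperBound

variable {α : ℝ} {E : Set (ℕ × ℕ)}

theorem EmptyTriangles.eq_of_vertical_between (hE : EmptyTriangles α E) (hα : 1 < α)
    {p q r : ℕ × ℕ} (hp : p ∈ E) (hq : q ∈ E) (hr : r ∈ E)
    (hpq : p.1 ≤ q.1) (hqr : q.1 ≤ r.1) (hpr : p.1 < r.1) (c : ℕ)
    (h : q.2 ≤ c ∧ (α ^ r.1 - α ^ p.1) * α ^ c ≤
        α ^ p.2 * (α ^ r.1 - α ^ q.1) + α ^ r.2 * (α ^ q.1 - α ^ p.1) ∨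
      c ≤ q.2 ∧ α ^ p.2 * (α ^ r.1 - α ^ q.1) + α ^ r.2 * (α ^ q.1 - α ^ p.1) ≤
        (α ^ r.1 - α ^ p.1) * α ^ c) :
    (q.1, c) = p ∨ (q.1, c) = q ∨ (q.1, c) = r := by
  have hmono : ∀ {m n : ℕ}, m ≤ n → α ^ m ≤ α ^ n := fun h => pow_le_pow_right₀ hα.le h
  obtain ⟨a, b, d, ha, hb, hd, hs, h1, h2⟩ :=
    exists_weights_of_vertical_between (hmono hpq) (hmono hqr) (pow_lt_pow_right₀ hα hpr)
      (h.imp (And.imp_left hmono) (And.imp_left hmono))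
  exact hE p hp q hq r hr (q.1, c) a b d ha hb hd hs h1 h2

/-- If the segment from `p` to `r` avoids `q` by at least the height `c`, then the lattice point of
height `c` on the vertical line through `q` is one of the two ends. -/
theorem EmptyTriangles.eq_or_eq_of_height (hE : EmptyTriangles α E) (hα : 1 < α)
    {p q r : ℕ × ℕ} (hp : p ∈ E) (hq : q ∈ E) (hr : r ∈ E)
    (hpq : p.1 ≤ q.1) (hqr : q.1 ≤ r.1) (hpr : p.1 < r.1) (c : ℕ)
    (hc : q.2 < c ∧ c ≤ p.2 ∧ c ≤ r.2 ∨ c < q.2 ∧ p.2 ≤ c ∧ r.2 ≤ c) :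
    q.1 = p.1 ∧ c = p.2 ∨ q.1 = r.1 ∧ c = r.2 := by
  have hmono : ∀ {m n : ℕ}, m ≤ n → α ^ m ≤ α ^ n := fun h => pow_le_pow_right₀ hα.le h
  have h1 := hmono hpq
  have h2 := hmono hqr
  have := hE.eq_of_vertical_between hα hp hq hr hpq hqr hpr c ?_
  · simp only [Prod.ext_iff] at this
    omega
  · rcases hc with ⟨hc, h3, h4⟩ | ⟨hc, h3, h4⟩
    · have h3 := hmono h3
      have h4 := hmono h4
      exact Or.inl ⟨hc.le, by nlinarith⟩
    · have h3 := hmono h3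
      have h4 := hmono h4
      exact Or.inr ⟨hc.le, by nlinarith⟩

/-- No point is in a strictly increasing pair and in a strictly decreasing pair. -/
theorem EmptyTriangles.not_increasing_and_decreasing (hE : EmptyTriangles α E) (hα : 1 < α)
    {p q r : ℕ × ℕ} (hp : p ∈ E) (hq : q ∈ E) (hr : r ∈ E)
    (hq' : p.1 < q.1 ∧ p.2 < q.2 ∨ q.1 < p.1 ∧ q.2 < p.2)
    (hr' : p.1 < r.1 ∧ r.2 < p.2 ∨ r.1 < p.1 ∧ p.2 < r.2) : False := by
  rcases hq' with ⟨h1, h2⟩ | ⟨h1, h2⟩ <;> rcases hr' with ⟨h3, h4⟩ | ⟨h3, h4⟩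
  · rcases le_total q.1 r.1 with h | h
    · have := hE.eq_or_eq_of_height hα hp hq hr h1.le h h3 p.2 (by omega)
      omega
    · have := hE.eq_or_eq_of_height hα hp hr hq h3.le h h1 p.2 (by omega)
      omega
  · have := hE.eq_or_eq_of_height hα hr hp hq h3.le h1.le (h3.trans h1) (min q.2 r.2) (by omega)
    omega
  · have := hE.eq_or_eq_of_height hα hq hp hr h1.le h3.le (h1.trans h3) (max q.2 r.2) (by omega)
    omega
  · rcases le_total q.1 r.1 with h | h
    · have := hE.eq_or_eq_of_height hα hq hr hp h h3.le h1 p.2 (by omega)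
      omega
    · have := hE.eq_or_eq_of_height hα hr hq hp h h1.le h3 p.2 (by omega)
      omega

/-- A set with empty triangles and more than four points is a chain: it has no strictly
increasing pair, or no strictly decreasing one. -/
theorem EmptyTriangles.increasing_or_decreasing (hE : EmptyTriangles α E) (hα : 1 < α)
    {F : Finset (ℕ × ℕ)} (hFE : ∀ p ∈ F, p ∈ E) (hF : 4 < F.card) :
    (∀ p ∈ F, ∀ q ∈ F, p.1 < q.1 → p.2 ≤ q.2) ∨ (∀ p ∈ F, ∀ q ∈ F, p.1 < q.1 → q.2 ≤ p.2) := by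
  by_contra! ⟨⟨w, hw, x, hx, hwx, hwx'⟩, ⟨u, hu, v, hv, huv, huv'⟩⟩
  have hcard : ({u, v, w, x} : Finset (ℕ × ℕ)).card < F.card := Finset.card_le_four.trans_lt hF
  obtain ⟨y, hy, hy'⟩ := Finset.exists_mem_notMem_of_card_lt_card hcard
  simp only [Finset.mem_insert, Finset.mem_singleton, not_or, Prod.ext_iff] at hy'
  have key : ∀ p ∈ F, ∀ q ∈ F, ∀ r ∈ F, ¬ ((p.1 < q.1 ∧ p.2 < q.2 ∨ q.1 < p.1 ∧ q.2 < p.2) ∧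
      (p.1 < r.1 ∧ r.2 < p.2 ∨ r.1 < p.1 ∧ p.2 < r.2)) := fun p hp q hq r hr h =>
    hE.not_increasing_and_decreasing hα (hFE p hp) (hFE q hq) (hFE r hr) h.1 h.2
  have hw' : ∀ z ∈ F, ¬ (w.1 < z.1 ∧ w.2 < z.2 ∨ z.1 < w.1 ∧ z.2 < w.2) := fun z hz h =>
    key w hw z hz x hx ⟨h, Or.inl ⟨hwx, hwx'⟩⟩
  have hx' : ∀ z ∈ F, ¬ (x.1 < z.1 ∧ x.2 < z.2 ∨ z.1 < x.1 ∧ z.2 < x.2) := fun z hz h =>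
    key x hx z hz w hw ⟨h, Or.inr ⟨hwx, hwx'⟩⟩
  have hu' : ∀ z ∈ F, ¬ (u.1 < z.1 ∧ z.2 < u.2 ∨ z.1 < u.1 ∧ u.2 < z.2) := fun z hz h =>
    key u hu v hv z hz ⟨Or.inl ⟨huv, huv'⟩, h⟩
  have hv' : ∀ z ∈ F, ¬ (v.1 < z.1 ∧ z.2 < v.2 ∨ z.1 < v.1 ∧ v.2 < z.2) := fun z hz h =>
    key v hv u hu z hz ⟨Or.inr ⟨huv, huv'⟩, h⟩
  have huw : u.1 = w.1 ∨ u.2 = w.2 := by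
    have h1 := hw' u hu
    have h2 := hu' w hw
    clear hy'; omega
  have hux : u.1 = x.1 ∨ u.2 = x.2 := by
    have h1 := hx' u hu
    have h2 := hu' x hx
    clear hy'; omega
  have hvw : v.1 = w.1 ∨ v.2 = w.2 := by
    have h1 := hw' v hv
    have h2 := hv' w hw
    clear hy'; omega
  have hvx : v.1 = x.1 ∨ v.2 = x.2 := by
    have h1 := hx' v hv
    have h2 := hv' x hx
    clear hy'; omega
  obtain ⟨e1, e2, e3, e4⟩ : u.1 = w.1 ∧ u.2 = x.2 ∧ v.1 = x.1 ∧ v.2 = w.2 := by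
    clear hy'; omega
  have y1 := hw' y hy
  have y2 := hx' y hy
  have y3 := hu' y hy
  have y4 := hv' y hy
  by_cases hdec : (y.1 < w.1 ∧ w.2 < y.2 ∨ w.1 < y.1 ∧ y.2 < w.2) ∨
      (y.1 < x.1 ∧ x.2 < y.2 ∨ x.1 < y.1 ∧ y.2 < x.2)
  · have hinc : ∀ z ∈ F, ¬ (y.1 < z.1 ∧ y.2 < z.2 ∨ z.1 < y.1 ∧ z.2 < y.2) := by
      intro z hz h
      rcases hdec with hd | hd
      · exact key y hy z hz w hw ⟨h, by clear hy'; omega⟩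
      · exact key y hy z hz x hx ⟨h, by clear hy'; omega⟩
    have hyu : y.1 = u.1 ∨ y.2 = u.2 := by
      have h := hinc u hu
      clear * - h y3; omega
    have hyv : y.1 = v.1 ∨ y.2 = v.2 := by
      have h := hinc v hv
      clear * - h y4; omega
    clear * - hyu hyv e1 e2 e3 e4 hy' hwx hwx'
    omega
  · have hyw : y.1 = w.1 ∨ y.2 = w.2 := by
      clear * - hdec y1; omega
    have hyx : y.1 = x.1 ∨ y.2 = x.2 := by
      clear * - hdec y2; omega
    clear * - hyw hyx e1 e2 e3 e4 hy' hwx hwx'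
    omega

theorem EmptyTriangles.not_collinear_column (hE : EmptyTriangles α E) (hα : 1 < α)
    {p q r : ℕ × ℕ} (hp : p ∈ E) (hr : r ∈ E)
    (h₁ : p.1 = q.1) (h₂ : q.1 = r.1) (h₃ : p.2 < q.2) (h₄ : q.2 < r.2) : False := by
  have h3 := pow_lt_pow_right₀ hα h₃
  have h4 := pow_lt_pow_right₀ hα h₄
  have hd : 0 < α ^ r.2 - α ^ p.2 := by linarith
  have := hE p hp r hr r hr q ((α ^ r.2 - α ^ q.2) / (α ^ r.2 - α ^ p.2))
    ((α ^ q.2 - α ^ p.2) / (α ^ r.2 - α ^ p.2)) 0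
    (div_nonneg (by linarith) hd.le) (div_nonneg (by linarith) hd.le) le_rfl
    (by field_simp; ring) (by rw [h₁, ← h₂]; field_simp; ring) (by field_simp; ring)
  simp only [Prod.ext_iff] at this
  omega

theorem EmptyTriangles.not_collinear_row (hE : EmptyTriangles α E) (hα : 1 < α)
    {p q r : ℕ × ℕ} (hp : p ∈ E) (hr : r ∈ E)
    (h₁ : p.2 = q.2) (h₂ : q.2 = r.2) (h₃ : p.1 < q.1) (h₄ : q.1 < r.1) : False :=
  hE.swap.not_collinear_column hα (p := p.swap) (q := q.swap) (r := r.swap) hp hr h₁ h₂ h₃ h₄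

/-- Three points with the same difference of exponents lie on a line through the origin. -/
theorem EmptyTriangles.not_collinear_diagonal (hE : EmptyTriangles α E) (hα : 1 < α)
    {p q r : ℕ × ℕ} (hp : p ∈ E) (hr : r ∈ E)
    (h₁ : q.2 + p.1 = p.2 + q.1) (h₂ : r.2 + q.1 = q.2 + r.1)
    (h₃ : p.1 < q.1) (h₄ : q.1 < r.1) : False := by
  have h3 := pow_lt_pow_right₀ hα h₃
  have h4 := pow_lt_pow_right₀ hα h₄
  have hd : 0 < α ^ r.1 - α ^ p.1 := by linarith
  have hq0 : (0 : ℝ) < α ^ q.1 := by positivity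
  have e1 : α ^ q.2 * α ^ p.1 = α ^ p.2 * α ^ q.1 := by rw [← pow_add, ← pow_add, h₁]
  have e2 : α ^ r.2 * α ^ q.1 = α ^ q.2 * α ^ r.1 := by rw [← pow_add, ← pow_add, h₂]
  have := hE p hp r hr r hr q ((α ^ r.1 - α ^ q.1) / (α ^ r.1 - α ^ p.1))
    ((α ^ q.1 - α ^ p.1) / (α ^ r.1 - α ^ p.1)) 0
    (div_nonneg (by linarith) hd.le) (div_nonneg (by linarith) hd.le) le_rfl
    (by field_simp; ring) (by field_simp; ring) (by
      field_simp
      refine mul_right_cancel₀ hq0.ne' ?_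
      linear_combination (-α ^ r.1 + α ^ q.1) * e1 + (α ^ q.1 - α ^ p.1) * e2)
  simp only [Prod.ext_iff] at this
  omega

theorem EmptyTriangles.not_steep_drop (hE : EmptyTriangles α E) (hα : 1 < α)
    (hα' : α + 1 ≤ α ^ 2) {p q r : ℕ × ℕ} (hp : p ∈ E) (hq : q ∈ E) (hr : r ∈ E) (hpq : p.1 ≤ q.1)
    (h : q.2 + 2 ≤ p.2 ∧ q.1 + 2 ≤ r.1 ∨ q.2 + 3 ≤ p.2 ∧ q.1 + 1 ≤ r.1) : False := by
  have hmono : ∀ {m n : ℕ}, m ≤ n → α ^ m ≤ α ^ n := fun h => pow_le_pow_right₀ hα.le h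
  have hα0 : 0 < α := by linarith
  have := hE.eq_of_vertical_between hα hp hq hr hpq (by omega) (by omega) (q.2 + 1)
    (Or.inl ⟨by omega, ?_⟩)
  · simp only [Prod.ext_iff] at this
    omega
  have hx1 : 0 < α ^ p.1 := by positivity
  have hx2 : 0 < α ^ q.1 := by positivity
  have hy2 : 0 < α ^ q.2 := by positivity
  have hy3 : 0 < α ^ r.2 := by positivity
  have h12 := hmono hpq
  suffices hs : α ^ r.1 * α ^ (q.2 + 1) ≤ α ^ p.2 * (α ^ r.1 - α ^ q.1) by
    have h1 : 0 ≤ α ^ p.1 * α ^ (q.2 + 1) := by positivity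
    have h2 : 0 ≤ α ^ r.2 * (α ^ q.1 - α ^ p.1) := mul_nonneg hy3.le (by linarith)
    linarith
  rcases h with ⟨h1, h2⟩ | ⟨h1, h2⟩
  · have h1 := hmono h1
    have h2 := hmono h2
    rw [pow_add] at h1 h2
    have h4 : 0 ≤ α ^ r.1 - α ^ q.1 := by nlinarith
    calc α ^ r.1 * α ^ (q.2 + 1) = α ^ q.2 * (α * α ^ r.1) := by ring
      _ ≤ α ^ q.2 * (α ^ 2 * (α ^ r.1 - α ^ q.1)) := by
        refine mul_le_mul_of_nonneg_left ?_ hy2.le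
        nlinarith
      _ = α ^ q.2 * α ^ 2 * (α ^ r.1 - α ^ q.1) := by ring
      _ ≤ _ := mul_le_mul_of_nonneg_right h1 h4
  · have h1 := hmono h1
    have h2 := hmono h2
    rw [pow_add] at h1 h2
    have h4 : 0 ≤ α ^ r.1 - α ^ q.1 := by nlinarith
    calc α ^ r.1 * α ^ (q.2 + 1) = α ^ q.2 * α * α ^ r.1 := by ring
      _ ≤ α ^ q.2 * α * (α ^ 2 * (α ^ r.1 - α ^ q.1)) := by
        refine mul_le_mul_of_nonneg_left ?_ (by positivity)
        nlinarith
      _ = α ^ q.2 * α ^ 3 * (α ^ r.1 - α ^ q.1) := by ring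
      _ ≤ _ := mul_le_mul_of_nonneg_right h1 h4

theorem EmptyTriangles.not_steep_rise (hE : EmptyTriangles α E) (hα : 1 < α)
    (hα' : α + 1 ≤ α ^ 2) {p q r : ℕ × ℕ} (hp : p ∈ E) (hq : q ∈ E) (hr : r ∈ E) (hqr : q.1 ≤ r.1)
    (h : p.1 + 1 ≤ q.1 ∧ q.2 + r.1 + 3 ≤ r.2 + q.1 ∨ p.1 + 2 ≤ q.1 ∧ q.2 + r.1 + 2 ≤ r.2 + q.1) :
    False := by
  have hmono : ∀ {m n : ℕ}, m ≤ n → α ^ m ≤ α ^ n := fun h => pow_le_pow_right₀ hα.le h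
  have hα0 : 0 < α := by linarith
  have := hE.eq_of_vertical_between hα hp hq hr (by omega) hqr (by omega) (q.2 + 1)
    (Or.inl ⟨by omega, ?_⟩)
  · simp only [Prod.ext_iff] at this
    omega
  have hx1 : 0 < α ^ p.1 := by positivity
  have hx2 : 0 < α ^ q.1 := by positivity
  have hx3 : 0 < α ^ r.1 := by positivity
  have hy2 : 0 < α ^ q.2 := by positivity
  have h23 := hmono hqr
  suffices hs : α ^ r.1 * α ^ (q.2 + 1) ≤ α ^ r.2 * (α ^ q.1 - α ^ p.1) by
    have h1 : 0 ≤ α ^ p.1 * α ^ (q.2 + 1) := by positivity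
    have h2 : 0 ≤ α ^ p.2 * (α ^ r.1 - α ^ q.1) := mul_nonneg (by positivity) (by linarith)
    linarith
  refine le_of_mul_le_mul_right ?_ hx2
  have hP : 0 < α ^ q.2 * α ^ r.1 := by positivity
  rcases h with ⟨h1, h2⟩ | ⟨h1, h2⟩
  · have h1 := hmono h1
    have h2 := hmono h2
    rw [pow_add] at h1
    rw [pow_add, pow_add, pow_add] at h2
    have h4 : 0 ≤ α ^ q.1 - α ^ p.1 := by nlinarith
    calc α ^ r.1 * α ^ (q.2 + 1) * α ^ q.1 = α ^ q.2 * α ^ r.1 * (α * α ^ q.1) := by ring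
      _ ≤ α ^ q.2 * α ^ r.1 * (α ^ 3 * (α ^ q.1 - α ^ p.1)) := by
        refine mul_le_mul_of_nonneg_left ?_ hP.le
        have : 0 ≤ α ^ 2 * (α ^ q.1 - α ^ p.1 * α ^ 1) := mul_nonneg (by positivity) (by linarith)
        have : 0 ≤ α * α ^ q.1 * (α ^ 2 - (α + 1)) := mul_nonneg (by positivity) (by linarith)
        linarith
      _ = α ^ q.2 * α ^ r.1 * α ^ 3 * (α ^ q.1 - α ^ p.1) := by ring
      _ ≤ α ^ r.2 * α ^ q.1 * (α ^ q.1 - α ^ p.1) := mul_le_mul_of_nonneg_right h2 h4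
      _ = _ := by ring
  · have h1 := hmono h1
    have h2 := hmono h2
    rw [pow_add] at h1
    rw [pow_add, pow_add, pow_add] at h2
    have h4 : 0 ≤ α ^ q.1 - α ^ p.1 := by nlinarith
    calc α ^ r.1 * α ^ (q.2 + 1) * α ^ q.1 = α ^ q.2 * α ^ r.1 * (α * α ^ q.1) := by ring
      _ ≤ α ^ q.2 * α ^ r.1 * (α ^ 2 * (α ^ q.1 - α ^ p.1)) := by
        refine mul_le_mul_of_nonneg_left ?_ hP.le
        nlinarith
      _ = α ^ q.2 * α ^ r.1 * α ^ 2 * (α ^ q.1 - α ^ p.1) := by ring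
      _ ≤ α ^ r.2 * α ^ q.1 * (α ^ q.1 - α ^ p.1) := mul_le_mul_of_nonneg_right h2 h4
      _ = _ := by ring

/-- In an increasing chain, the difference of the exponents has a strict local maximum only at the
corner of a unit square. -/
theorem EmptyTriangles.unit_corner_of_peak (hE : EmptyTriangles α E) (hα : 1 < α)
    {p q r : ℕ × ℕ} (hp : p ∈ E) (hq : q ∈ E) (hr : r ∈ E)
    (hpq : p.1 ≤ q.1) (hqr : q.2 ≤ r.2)
    (h₁ : p.2 + q.1 < q.2 + p.1) (h₂ : r.2 + q.1 < q.2 + r.1) :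
    p.1 = q.1 ∧ p.2 + 1 = q.2 ∧ r.1 = q.1 + 1 ∧ r.2 = q.2 := by
  have hα0 : 0 < α := by linarith
  have hx2 : 0 < α ^ q.1 := by positivity
  have hy2 : 0 < α ^ q.2 := by positivity
  have hmono : ∀ {m n : ℕ}, m ≤ n → α ^ m ≤ α ^ n := fun h => pow_le_pow_right₀ hα.le h
  have ha := hmono (Nat.succ_le_of_lt h₁)
  have hb := hmono (Nat.succ_le_of_lt h₂)
  rw [Nat.succ_eq_add_one, pow_succ, pow_add, pow_add] at ha hb
  have hx12 := hmono hpq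
  have hx23 := hmono (show q.1 ≤ r.1 by omega)
  have hy12 := hmono (show p.2 ≤ q.2 by omega)
  have hy23 := hmono hqr
  have hv := hE.eq_of_vertical_between hα hp hq hr hpq (by omega) (by omega) (q.2 - 1)
    (Or.inr ⟨by omega, ?_⟩)
  · have hh := hE.swap.eq_of_vertical_between hα (p := p.swap) (q := q.swap) (r := r.swap) hp hq hr
      (by simp; omega) (by simp; omega) (by simp; omega) (q.1 + 1) (Or.inl ⟨by simp, ?_⟩)
    · simp only [Prod.ext_iff, Prod.fst_swap, Prod.snd_swap] at hv hh
      omega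
    · simp only [Prod.fst_swap, Prod.snd_swap]
      refine le_of_mul_le_mul_right ?_ hy2
      have h3 := mul_le_mul_of_nonneg_right ha (sub_nonneg.2 hy23)
      have h4 := mul_le_mul_of_nonneg_right hb (sub_nonneg.2 hy12)
      rw [pow_succ]
      linarith
  · obtain ⟨c, hc⟩ : ∃ c, q.2 = c + 1 := ⟨q.2 - 1, by omega⟩
    rw [hc, pow_succ] at ha hb
    rw [hc, Nat.add_sub_cancel]
    refine le_of_mul_le_mul_right ?_ (mul_pos hx2 hα0)
    have h3 := mul_le_mul_of_nonneg_right ha (sub_nonneg.2 hx23)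
    have h4 := mul_le_mul_of_nonneg_right hb (sub_nonneg.2 hx12)
    linarith

theorem EmptyTriangles.not_increasing_chain_of_le (hE : EmptyTriangles α E) (hα : 1 < α)
    (hα' : α + 1 ≤ α ^ 2) {f : Fin 8 → ℕ × ℕ} (hf : ∀ i, f i ∈ E)
    (hmono : ∀ i j, i < j → (f i).1 ≤ (f j).1 ∧ (f i).2 ≤ (f j).2 ∧
      (f i).1 + (f i).2 < (f j).1 + (f j).2)
    (hle : (f 0).2 + (f 7).1 ≤ (f 7).2 + (f 0).1) : False := by
  have hlt : ∀ i j k, i < j → j < k → (f i).1 < (f k).1 ∧ (f i).2 < (f k).2 := by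
    intro i j k hij hjk
    have h1 := hmono i j hij
    have h2 := hmono j k hjk
    have hc := hE.not_collinear_column hα (hf i) (q := f j) (hf k)
    have hr := hE.not_collinear_row hα (hf i) (q := f j) (hf k)
    constructor <;> by_contra! h
    · exact hc (by omega) (by omega) (by omega) (by omega)
    · exact hr (by omega) (by omega) (by omega) (by omega)
  let t : Fin 8 → ℤ := fun i => (f i).2 - (f i).1
  have ht : ∀ i, t i = (f i).2 - (f i).1 := fun _ => rfl
  have hpeak : ∀ i j k : Fin 8, i < j → j < k → (i : ℕ) + 3 ≤ k → ¬ (t i < t j ∧ t k < t j) := by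
    rintro i j k hij hjk hik ⟨h1, h2⟩
    rw [ht, ht] at h1 h2
    have hc := hE.unit_corner_of_peak hα (hf i) (hf j) (hf k) (hmono i j hij).1
      (hmono j k hjk).2.1 (by omega) (by omega)
    obtain h | h : (i : ℕ) + 1 < j ∨ (j : ℕ) + 1 < k := by omega
    · have := hlt i ⟨i + 1, by omega⟩ j (Fin.lt_def.2 (by simp)) (Fin.lt_def.2 h)
      omega
    · have := hlt j ⟨j + 1, by omega⟩ k (Fin.lt_def.2 (by simp)) (Fin.lt_def.2 h)
      omega
  have hvalley : ∀ i j k : Fin 8, i < j → j < k → (i : ℕ) + 3 ≤ k → ¬ (t j < t i ∧ t j < t k) := by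
    rintro i j k hij hjk hik ⟨h1, h2⟩
    rw [ht, ht] at h1 h2
    have hc := hE.swap.unit_corner_of_peak hα (p := (f i).swap) (q := (f j).swap)
      (r := (f k).swap) (hf i) (hf j) (hf k) (hmono i j hij).2.1
      (hmono j k hjk).1 (by simp only [Prod.fst_swap, Prod.snd_swap]; omega)
      (by simp only [Prod.fst_swap, Prod.snd_swap]; omega)
    simp only [Prod.fst_swap, Prod.snd_swap] at hc
    obtain h | h : (i : ℕ) + 1 < j ∨ (j : ℕ) + 1 < k := by omega
    · have := hlt i ⟨i + 1, by omega⟩ j (Fin.lt_def.2 (by simp)) (Fin.lt_def.2 h)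
      omega
    · have := hlt j ⟨j + 1, by omega⟩ k (Fin.lt_def.2 (by simp)) (Fin.lt_def.2 h)
      omega
  have hdiag : ∀ i j k, i < j → j < k → ¬ (t i = t j ∧ t j = t k) := by
    rintro i j k hij hjk ⟨h1, h2⟩
    rw [ht, ht] at h1 h2
    have h3 := hmono i j hij
    have h4 := hmono j k hjk
    exact hE.not_collinear_diagonal hα (hf i) (q := f j) (hf k) (by omega) (by omega) (by omega)
      (by omega)
  have hsteep : ∀ i j k, i < j → j < k → ¬ ((f i).1 + 1 ≤ (f j).1 ∧ t j + 3 ≤ t k ∨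
      (f i).1 + 2 ≤ (f j).1 ∧ t j + 2 ≤ t k) := by
    intro i j k _ hjk h
    simp only [ht] at h
    exact hE.not_steep_rise hα hα' (hf i) (hf j) (hf k) (hmono j k hjk).1 (by omega)
  have h07 : t 0 ≤ t 7 := by simp only [ht]; omega
  have hmid : ∀ i j : Fin 8, i < j → j < 7 → (i : ℕ) + 3 ≤ 7 → t i ≤ t 7 →
      t i ≤ t j ∧ t j ≤ t 7 := by
    intro i j hij hj hi h
    have h1 := hpeak i j 7 hij hj hi
    have h2 := hvalley i j 7 hij hj hi
    omega
  have h2 := hmid 0 2 (by decide) (by decide) (by decide) h07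
  have h3 := hmid 2 3 (by decide) (by decide) (by decide) h2.2
  have h4 := hmid 3 4 (by decide) (by decide) (by decide) h3.2
  have h5 := hmid 4 5 (by decide) (by decide) (by decide) h4.2
  have h6 := hmid 4 6 (by decide) (by decide) (by decide) h4.2
  have d1 := hdiag 2 3 4 (by decide) (by decide)
  have d2 := hdiag 3 4 5 (by decide) (by decide)
  have d3 := hdiag 3 4 6 (by decide) (by decide)
  have d4 := hdiag 5 6 7 (by decide) (by decide)
  have s1 := hsteep 0 2 7 (by decide) (by decide)
  have s2 := hsteep 0 3 7 (by decide) (by decide)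
  have l1 := hlt 0 1 2 (by decide) (by decide)
  have l2 := hmono 2 3 (by decide)
  have ht2 := ht 2
  have ht3 := ht 3
  clear hpeak hvalley hdiag hsteep hmid hlt
  have h27 : t 7 ≤ t 2 + 2 := by omega
  have h23 : t 3 = t 2 := by clear s1 s2 ht2 ht3; omega
  have h27' : t 7 = t 2 + 2 := by clear s1 s2 ht2 ht3; omega
  omega

theorem EmptyTriangles.not_increasing_chain (hE : EmptyTriangles α E) (hα : 1 < α)
    (hα' : α + 1 ≤ α ^ 2) {f : Fin 8 → ℕ × ℕ} (hf : ∀ i, f i ∈ E)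
    (hmono : ∀ i j, i < j → (f i).1 ≤ (f j).1 ∧ (f i).2 ≤ (f j).2 ∧
      (f i).1 + (f i).2 < (f j).1 + (f j).2) : False := by
  rcases le_total ((f 0).2 + (f 7).1) ((f 7).2 + (f 0).1) with h | h
  · exact hE.not_increasing_chain_of_le hα hα' hf hmono h
  · refine hE.swap.not_increasing_chain_of_le hα hα' (f := fun i => (f i).swap) hf ?_ ?_
    · intro i j hij
      have := hmono i j hij
      simp only [Prod.fst_swap, Prod.snd_swap]
      omega
    · simp only [Prod.fst_swap, Prod.snd_swap]
      omega

theorem EmptyTriangles.not_decreasing_chain (hE : EmptyTriangles α E) (hα : 1 < α)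
    (hα' : α + 1 ≤ α ^ 2) {f : Fin 8 → ℕ × ℕ} (hf : ∀ i, f i ∈ E)
    (hmono : ∀ i j, i < j → (f i).1 ≤ (f j).1 ∧ (f j).2 ≤ (f i).2 ∧
      (f i).1 + (f j).2 < (f j).1 + (f i).2) : False := by
  have hlt : ∀ i j k, i < j → j < k → (f i).1 < (f k).1 ∧ (f k).2 < (f i).2 := by
    intro i j k hij hjk
    have h1 := hmono i j hij
    have h2 := hmono j k hjk
    have hc := hE.not_collinear_column hα (hf k) (q := f j) (hf i)
    have hr := hE.not_collinear_row hα (hf i) (q := f j) (hf k)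
    constructor <;> by_contra! h
    · exact hc (by omega) (by omega) (by omega) (by omega)
    · exact hr (by omega) (by omega) (by omega) (by omega)
  have hsteep : ∀ j, 0 < j → j < 7 →
      ¬ ((f j).2 + 2 ≤ (f 0).2 ∧ (f j).1 + 2 ≤ (f 7).1 ∨
        (f j).2 + 1 ≤ (f 0).2 ∧ (f j).1 + 3 ≤ (f 7).1) := by
    rintro j h0 h7 (h | h)
    · exact hE.not_steep_drop hα hα' (hf 0) (hf j) (hf 7) (hmono 0 j h0).1 (Or.inl h)
    · exact hE.swap.not_steep_drop hα hα' (p := (f 7).swap) (q := (f j).swap) (r := (f 0).swap)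
        (hf 7) (hf j) (hf 0) (hmono j 7 h7).2.1 (Or.inr ⟨h.2, h.1⟩)
  have s2 := hsteep 2 (by decide) (by decide)
  have s3 := hsteep 3 (by decide) (by decide)
  have l2 := hlt 0 1 2 (by decide) (by decide)
  have l3 := hmono 2 3 (by decide)
  have l5 := hlt 3 4 5 (by decide) (by decide)
  have l7 := hlt 5 6 7 (by decide) (by decide)
  omega

/-- A finite set of exponents with empty triangles has at most seven elements. -/
theorem EmptyTriangles.card_le_seven (hE : EmptyTriangles α E) (hα : 1 < α)
    (hα' : α + 1 ≤ α ^ 2) {F : Finset (ℕ × ℕ)} (hFE : ∀ p ∈ F, p ∈ E) : F.card ≤ 7 := by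
  by_contra! hF
  obtain ⟨G, hGF, hG⟩ := Finset.exists_subset_card_eq (Nat.succ_le_of_lt hF)
  have hGE : ∀ p ∈ G, p ∈ E := fun p hp => hFE p (hGF hp)
  have enum : ∀ key : ℕ × ℕ → ℤ, (∀ p ∈ G, ∀ q ∈ G, key p = key q → p = q) →
      ∃ f : Fin 8 → ℕ × ℕ, (∀ i, f i ∈ G) ∧ ∀ i j, i < j → key (f i) < key (f j) := by
    intro key hkey
    have hc : (G.image key).card = 8 := by
      rw [Finset.card_image_of_injOn (fun p hp q hq => hkey p hp q hq), hG]
    have hmem : ∀ i, ∃ p ∈ G, key p = (G.image key).orderEmbOfFin hc i := fun i =>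
      Finset.mem_image.1 ((G.image key).orderEmbOfFin_mem hc i)
    choose f hfG hfk using hmem
    refine ⟨f, hfG, fun i j hij => ?_⟩
    rw [hfk, hfk]
    exact ((G.image key).orderEmbOfFin hc).strictMono hij
  rcases hE.increasing_or_decreasing hα hGE (by omega) with h | h
  · obtain ⟨f, hfG, hf⟩ := enum (fun p => (p.1 : ℤ) + p.2) (by
      intro p hp q hq hpq
      have h1 := h p hp q hq
      have h2 := h q hq p hp
      ext <;> omega)
    refine hE.not_increasing_chain hα hα' (fun i => hGE _ (hfG i)) (f := f) fun i j hij => ?_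
    have h0 := hf i j hij
    have h1 := h _ (hfG i) _ (hfG j)
    have h2 := h _ (hfG j) _ (hfG i)
    omega
  · obtain ⟨f, hfG, hf⟩ := enum (fun p => (p.1 : ℤ) - p.2) (by
      intro p hp q hq hpq
      have h1 := h p hp q hq
      have h2 := h q hq p hp
      ext <;> omega)
    refine hE.not_decreasing_chain hα hα' (fun i => hGE _ (hfG i)) (f := f) fun i j hij => ?_
    have h0 := hf i j hij
    have h1 := h _ (hfG i) _ (hfG j)
    have h2 := h _ (hfG j) _ (hfG i)
    omega

end UpperBound

/-- The lattice point with the given exponents. -/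
def expPoint (α : ℝ) (p : ℕ × ℕ) : ℝ × ℝ := (α ^ p.1, α ^ p.2)

theorem expPoint_injective {α : ℝ} (hα : 1 < α) : Function.Injective (expPoint α) := by
  intro p q h
  obtain ⟨h1, h2⟩ := Prod.ext_iff.1 h
  exact Prod.ext (pow_right_injective₀ (by linarith) hα.ne' h1)
    (pow_right_injective₀ (by linarith) hα.ne' h2)

theorem IsEmptyPolygonIn.emptyTriangles {α : ℝ} (hα : 1 < α) {X : Set (ℝ × ℝ)}
    (hX : IsEmptyPolygonIn (expLattice α) X) : EmptyTriangles α (expPoint α ⁻¹' X) := by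
  obtain ⟨-, hconv, hhull⟩ := hX
  intro p hp q hq r hr z a b c ha hb hc habc h1 h2
  by_contra! hz
  have hcomb : ∀ Y : Set (ℝ × ℝ), expPoint α p ∈ Y → expPoint α q ∈ Y → expPoint α r ∈ Y →
      expPoint α z ∈ convexHull ℝ Y := by
    intro Y hpY hqY hrY
    have := (convex_convexHull ℝ Y).sum_mem (t := Finset.univ) (w := ![a, b, c])
      (z := ![expPoint α p, expPoint α q, expPoint α r]) (by
        intro i _; fin_cases i <;> assumption) (by simpa [Fin.sum_univ_three] using habc) (by
        intro i _
        fin_cases i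
        exacts [subset_convexHull ℝ Y hpY, subset_convexHull ℝ Y hqY, subset_convexHull ℝ Y hrY])
    convert this using 1
    simp only [Fin.sum_univ_three, expPoint, Prod.ext_iff]
    simp [h1, h2]
  have hzX : expPoint α z ∈ X := by
    rw [← hhull]
    exact ⟨hcomb X hp hq hr, z.1, z.2, rfl⟩
  have hne : ∀ y, z ≠ y → expPoint α y ≠ expPoint α z := fun y h =>
    (expPoint_injective hα).ne h.symm
  exact hconv _ hzX (hcomb _ ⟨hp, hne p hz.1⟩ ⟨hq, hne q hz.2.1⟩ ⟨hr, hne r hz.2.2⟩)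

theorem IsEmptyPolygonIn.ncard_le_seven {α : ℝ} (hα : 1 < α) (hα' : α + 1 ≤ α ^ 2)
    {X : Set (ℝ × ℝ)} (hfin : X.Finite) (hX : IsEmptyPolygonIn (expLattice α) X) :
    X.ncard ≤ 7 := by
  have hinj := expPoint_injective hα
  have hE : (expPoint α ⁻¹' X).Finite := hfin.preimage hinj.injOn
  have himage : expPoint α '' (expPoint α ⁻¹' X) = X := by
    refine Set.image_preimage_eq_of_subset fun x hx => ?_
    obtain ⟨m, n, rfl⟩ := hX.1 hx
    exact ⟨(m, n), rfl⟩
  rw [← himage, Set.ncard_image_of_injective _ hinj, Set.ncard_eq_toFinset_card _ hE]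
  exact (hX.emptyTriangles hα).card_le_seven hα hα' fun p hp => hE.mem_toFinset.1 hp

section LowerBound

/-- Exponents of the vertices of an empty heptagon in the exponential lattice. -/
def heptagon (n : ℕ) : Finset (ℕ × ℕ) :=
  {(0, n + 2), (1, n + 2), (n, n + 1), (n + 1, n), (n + 1, n + 1), (n + 2, 0), (n + 2, 1)}

theorem card_heptagon {n : ℕ} (hn : 1 ≤ n) : (heptagon n).card = 7 := by
  have h0 : n ≠ 0 := by omega
  rw [heptagon]
  repeat rw [Finset.card_insert_of_notMem (by simp; try omega)]
  simp

theorem swap_mem_heptagon {n : ℕ} {p : ℕ × ℕ} (hp : p ∈ heptagon n) : p.swap ∈ heptagon n := by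
  simp only [heptagon, Finset.mem_insert, Finset.mem_singleton, Prod.ext_iff, Prod.fst_swap,
    Prod.snd_swap] at hp ⊢
  omega

theorem isLinearMap_mul_fst_add_mul_snd (a b : ℝ) :
    IsLinearMap ℝ fun x : ℝ × ℝ => a * x.1 + b * x.2 :=
  ⟨fun x y => by simp only [Prod.fst_add, Prod.snd_add]; ring,
    fun k x => by simp only [Prod.smul_fst, Prod.smul_snd, smul_eq_mul]; ring⟩

theorem heptagon_le_of_mem_convexHull {α a b c : ℝ} {n : ℕ}
    (h : ∀ p ∈ heptagon n, a * α ^ p.1 + b * α ^ p.2 ≤ c) {z : ℝ × ℝ}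
    (hz : z ∈ convexHull ℝ (expPoint α '' heptagon n)) :
    a * z.1 + b * z.2 ≤ c ∧ b * z.1 + a * z.2 ≤ c := by
  constructor
  · refine convexHull_min ?_ (convex_halfSpace_le (isLinearMap_mul_fst_add_mul_snd a b) c) hz
    rintro _ ⟨p, hp, rfl⟩
    exact h p hp
  · refine convexHull_min ?_ (convex_halfSpace_le (isLinearMap_mul_fst_add_mul_snd b a) c) hz
    rintro _ ⟨p, hp, rfl⟩
    have := h p.swap (swap_mem_heptagon hp)
    rw [add_comm] at this
    exact this

/-- A vertex at which a linear functional is strictly maximal, and its mirror image, are not in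
the convex hull of the other vertices. -/
theorem heptagon_notMem_convexHull {α a b : ℝ} {n : ℕ} {v : ℕ × ℕ}
    (h : ∀ p ∈ heptagon n, p ≠ v → a * α ^ p.1 + b * α ^ p.2 < a * α ^ v.1 + b * α ^ v.2) :
    expPoint α v ∉ convexHull ℝ (expPoint α '' heptagon n \ {expPoint α v}) ∧
    expPoint α v.swap ∉ convexHull ℝ (expPoint α '' heptagon n \ {expPoint α v.swap}) := by
  constructor <;> intro hv
  · refine lt_irrefl (a * α ^ v.1 + b * α ^ v.2)
      (convexHull_min ?_ (convex_halfSpace_lt (isLinearMap_mul_fst_add_mul_snd a b) _) hv)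
    rintro _ ⟨⟨p, hp, rfl⟩, hpv⟩
    exact h p hp fun e => hpv (e ▸ rfl)
  · refine lt_irrefl (b * α ^ v.2 + a * α ^ v.1)
      (convexHull_min ?_ (convex_halfSpace_lt (isLinearMap_mul_fst_add_mul_snd b a) _) hv)
    rintro _ ⟨⟨p, hp, rfl⟩, hpv⟩
    have := h p.swap (swap_mem_heptagon hp) fun e => hpv (by rw [← e, Prod.swap_swap]; rfl)
    rw [add_comm, add_comm (a * α ^ v.1)] at this
    exact this

theorem forall_mem_heptagon {α : ℝ} {n : ℕ} {P : ℕ × ℕ → ℝ → ℝ → Prop} :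
    (∀ p ∈ heptagon n, P p (α ^ p.1) (α ^ p.2)) ↔
      P (0, n + 2) 1 (α ^ 2 * α ^ n) ∧ P (1, n + 2) α (α ^ 2 * α ^ n) ∧
      P (n, n + 1) (α ^ n) (α * α ^ n) ∧ P (n + 1, n) (α * α ^ n) (α ^ n) ∧
      P (n + 1, n + 1) (α * α ^ n) (α * α ^ n) ∧ P (n + 2, 0) (α ^ 2 * α ^ n) 1 ∧
      P (n + 2, 1) (α ^ 2 * α ^ n) α := by
  simp only [heptagon, Finset.forall_mem_insert, Finset.mem_singleton, forall_eq, pow_zero,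
    pow_one, pow_add, mul_comm (α ^ n)]

variable {α : ℝ} {n : ℕ}

theorem lt_pow_of_one_lt_mul (hα₂ : α < 2) (hn : 1 < α ^ n * (2 - α)) : α < α ^ n := by
  nlinarith [sq_nonneg (α - 1)]

theorem strictConvexPos_heptagon (hα : 1 < α) (hα' : α + 1 ≤ α ^ 2) (hα₂ : α < 2)
    (hn : 1 < α ^ n * (2 - α)) : StrictConvexPos (expPoint α '' heptagon n) := by
  have hsep := fun (a b : ℝ) (v : ℕ × ℕ) h => heptagon_notMem_convexHull (v := v)
    (forall_mem_heptagon (α := α) (n := n)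
      (P := fun p x y => p ≠ v → a * x + b * y < a * α ^ v.1 + b * α ^ v.2).2 h)
  have huα := lt_pow_of_one_lt_mul hα₂ hn
  obtain ⟨u, hu⟩ : ∃ u, u = α ^ n := ⟨_, rfl⟩
  simp only [← hu] at hn huα hsep
  have hu0 : 0 < u := by linarith
  have hαu : u < α * u := by nlinarith
  have hααu : α * u < α ^ 2 * u := by nlinarith
  have h1 := hsep (-1) 0 (0, n + 2) (by
    simp only [pow_add, pow_zero, ← hu]
    refine ⟨fun h => (h rfl).elim, ?_, ?_, ?_, ?_, ?_, ?_⟩ <;> intro _ <;> linarith)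
  have h2 := hsep (α - 1) (α ^ 2) (1, n + 2) (by
    simp only [pow_add, pow_one, ← hu]
    refine ⟨?_, fun h => (h rfl).elim, ?_, ?_, ?_, ?_, ?_⟩ <;> intro _ <;> nlinarith)
  have h3 := hsep (-(α * u * (α - 1) + 1)) (-u) (n, n + 1) (by
    simp only [pow_add, pow_one, ← hu]
    have hs : 0 ≤ (α ^ 2 - α - 1) * u := mul_nonneg (by linarith) hu0.le
    refine ⟨?_, ?_, fun h => (h rfl).elim, ?_, ?_, ?_, ?_⟩ <;> intro _ <;> nlinarith)
  have h5 := hsep 1 1 (n + 1, n + 1) (by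
    simp only [pow_add, pow_one, ← hu]
    refine ⟨?_, ?_, ?_, ?_, fun h => (h rfl).elim, ?_, ?_⟩ <;> intro _ <;> nlinarith)
  rintro _ ⟨v, hv, rfl⟩
  simp only [heptagon, Finset.coe_insert, Finset.coe_singleton, Set.mem_insert_iff,
    Set.mem_singleton_iff] at hv
  rcases hv with rfl | rfl | rfl | rfl | rfl | rfl | rfl
  exacts [h1.1, h2.1, h3.1, h3.2, h5.1, h1.2, h2.2]

/-- Linear inequalities satisfied on the convex hull of the heptagon. -/
theorem heptagon_edges_of_mem_convexHull (hα : 1 < α) (hα' : α + 1 ≤ α ^ 2) (hα₂ : α < 2) {u : ℝ}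
    (hu : u = α ^ n) (hn : 1 < u * (2 - α)) {z : ℝ × ℝ}
    (hz : z ∈ convexHull ℝ (expPoint α '' heptagon n)) :
    (z.1 ≤ α ^ 2 * u ∧ z.2 ≤ α ^ 2 * u) ∧ u * (1 + α) ≤ z.1 + z.2 ∧
      ((u - 1) * (α ^ 2 * u - z.2) ≤ α * u * (α - 1) * (z.1 - 1) ∧
        (u - 1) * (α ^ 2 * u - z.1) ≤ α * u * (α - 1) * (z.2 - 1)) ∧
      u * (α - 1) * (z.1 - α) ≤ (u - 1) * (α ^ 2 * u - z.2) ∧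
        u * (α - 1) * (z.2 - α) ≤ (u - 1) * (α ^ 2 * u - z.1) := by
  have hle := fun (a b c : ℝ) h => heptagon_le_of_mem_convexHull
    (forall_mem_heptagon (P := fun p x y => a * x + b * y ≤ c).2 h) hz
  simp only [← hu] at hle
  have huα : α < u := hu ▸ lt_pow_of_one_lt_mul hα₂ (hu ▸ hn)
  have hu0 : 0 < u := by linarith
  have hαu : u < α * u := by nlinarith
  have hααu : α * u < α ^ 2 * u := by nlinarith
  have hs : 0 ≤ (α ^ 2 - α - 1) * u := mul_nonneg (by linarith) hu0.le
  have hx := hle 1 0 (α ^ 2 * u) (by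
    refine ⟨?_, ?_, ?_, ?_, ?_, ?_, ?_⟩ <;> linarith)
  have hxy := hle (-1) (-1) (-(u * (1 + α))) (by
    refine ⟨?_, ?_, ?_, ?_, ?_, ?_, ?_⟩ <;> linarith)
  have hF := hle (-(α * u * (α - 1))) (-(u - 1)) (-(α * u * (α - 1) + (u - 1) * (α ^ 2 * u))) (by
    refine ⟨?_, ?_, ?_, ?_, ?_, ?_, ?_⟩ <;> nlinarith)
  have hG := hle (u * (α - 1)) (u - 1) (u * (α - 1) * α + (u - 1) * (α ^ 2 * u)) (by
    refine ⟨?_, ?_, ?_, ?_, ?_, ?_, ?_⟩ <;> nlinarith)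
  clear hle
  refine ⟨⟨?_, ?_⟩, ?_, ⟨?_, ?_⟩, ?_, ?_⟩ <;> linarith

theorem convexHull_heptagon_inter (hα : 1 < α) (hα' : α + 1 ≤ α ^ 2) (hα₂ : α < 2)
    (hn : 1 < α ^ n * (2 - α)) :
    convexHull ℝ (expPoint α '' heptagon n) ∩ expLattice α = expPoint α '' heptagon n := by
  have hlt : ∀ {k l : ℕ}, α ^ k ≤ α ^ l → k ≤ l := fun h => (pow_le_pow_iff_right₀ hα).1 h
  have hmono : ∀ {k l : ℕ}, k ≤ l → α ^ k ≤ α ^ l := fun h => pow_le_pow_right₀ hα.le h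
  refine Set.Subset.antisymm ?_ (Set.subset_inter (subset_convexHull ℝ _) ?_)
  swap
  · rintro _ ⟨p, -, rfl⟩
    exact ⟨p.1, p.2, rfl⟩
  rintro _ ⟨hz, i, j, rfl⟩
  have huα := lt_pow_of_one_lt_mul hα₂ hn
  have hu1 : α ^ (n + 1) = α * α ^ n := by ring
  have hu2 : α ^ (n + 2) = α ^ 2 * α ^ n := by ring
  obtain ⟨u, hu⟩ : ∃ u, u = α ^ n := ⟨_, rfl⟩
  rw [← hu] at hn huα hu1 hu2
  obtain ⟨⟨hx, hy⟩, hxy, hF, hG⟩ := heptagon_edges_of_mem_convexHull hα hα' hα₂ hu hn hz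
  have hu0 : 0 < u := by linarith
  have hαu : u < α * u := by nlinarith
  have huα1 : 0 < u * (α - 1) := mul_pos hu0 (by linarith)
  have hright : ∀ {k l : ℕ}, u * (α - 1) * (α ^ k - α) ≤ (u - 1) * (α ^ 2 * u - α ^ l) →
      l = n + 2 → k ≤ 1 := by
    rintro k l h rfl
    rw [hu2, sub_self, mul_zero] at h
    refine hlt ?_
    rw [pow_one]
    exact sub_nonpos.1 (nonpos_of_mul_nonpos_right h huα1)
  have hleft : ∀ {k l : ℕ}, (u - 1) * (α ^ 2 * u - α ^ l) ≤ α * u * (α - 1) * (α ^ k - 1) →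
      l = n + 1 → n ≤ k := by
    rintro k l h rfl
    rw [hu1] at h
    refine hlt ?_
    rw [← hu]
    exact le_of_mul_le_mul_left (a := α * (u * (α - 1))) (by linarith)
      (mul_pos (by linarith) huα1)
  have hi : i ≤ n + 2 := hlt (hx.trans_eq hu2.symm)
  have hj : j ≤ n + 2 := hlt (hy.trans_eq hu2.symm)
  have hj2 := hright hG.1
  have hi2 := hright hG.2
  have hj1 := hleft hF.1
  have hi1 := hleft hF.2
  have hij : ¬ (i ≤ n ∧ j ≤ n) := by
    rintro ⟨h1, h2⟩
    have h1 := hmono h1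
    have h2 := hmono h2
    simp only at hxy
    linarith
  refine ⟨(i, j), ?_, rfl⟩
  simp only [heptagon, Finset.coe_insert, Finset.coe_singleton, Set.mem_insert_iff,
    Set.mem_singleton_iff, Prod.mk.injEq]
  clear hright hleft
  obtain h | h | h | h : j = n + 2 ∨ i = n + 2 ∨ j = n + 1 ∨ i = n + 1 := by omega
  · have := hj2 h
    omega
  · have := hi2 h
    omega
  · have := hj1 h
    omega
  · have := hi1 h
    omega

theorem exists_empty_heptagon (hα : 1 < α) (hα' : α + 1 ≤ α ^ 2) (hα₂ : α < 2) :
    ∃ X : Set (ℝ × ℝ), X.Finite ∧ IsEmptyPolygonIn (expLattice α) X ∧ X.ncard = 7 := by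
  obtain ⟨n, hn⟩ := pow_unbounded_of_one_lt (1 / (2 - α)) hα
  rw [div_lt_iff₀ (by linarith)] at hn
  have hn0 : 1 ≤ n := by
    by_contra! h
    obtain rfl : n = 0 := by omega
    linarith
  refine ⟨expPoint α '' heptagon n, (heptagon n).finite_toSet.image _, ⟨?_, ?_, ?_⟩, ?_⟩
  · rintro _ ⟨p, -, rfl⟩
    exact ⟨p.1, p.2, rfl⟩
  · exact strictConvexPos_heptagon hα hα' hα₂ hn
  · exact convexHull_heptagon_inter hα hα' hα₂ hn
  · rw [Set.ncard_image_of_injective _ (expPoint_injective hα), Set.ncard_coe_finset,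
      card_heptagon hn0]

end LowerBound

theorem h_eq_seven (α : ℝ) (hα₁ : (1 + Real.sqrt 5) / 2 ≤ α) (hα₂ : α < 2) :
    (∃ X : Set (ℝ × ℝ), X.Finite ∧ IsEmptyPolygonIn (expLattice α) X ∧ X.ncard = 7) ∧
    (∀ X : Set (ℝ × ℝ), X.Finite → IsEmptyPolygonIn (expLattice α) X → X.ncard ≤ 7) := by
  have h5 := Real.sq_sqrt (show (0 : ℝ) ≤ 5 by norm_num)
  have h5' := Real.sqrt_nonneg 5
  have hα : 1 < α := by nlinarith
  have hα' : α + 1 ≤ α ^ 2 := by nlinarith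
  exact ⟨exists_empty_heptagon hα hα' hα₂, fun X hfin hX => hX.ncard_le_seven hα hα' hfin⟩
end

section
/- Let (F_n) be the Fibonacci numbers with F_0 = F_1 = 1 and F_{n+2} = F_{n+1} + F_n, and let 𝔉 = {F_n : n ∈ ℕ₀}² ⊆ ℝ². Then h(𝔉) = ∞; that is, for every positive integer k there exists a finite subset X ⊆ 𝔉 with |X| ≥ k that is in strictly convex position and satisfies conv(X) ∩ 𝔉 = X. -/
theorem convex_lt_linear_prod (a b c : ℝ) :
    Convex ℝ {p : ℝ × ℝ | c < a * p.1 + b * p.2} :=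
  convex_halfSpace_gt
    ⟨fun x y => by simp only [Prod.fst_add, Prod.snd_add]; ring,
      fun t x => by simp only [Prod.smul_fst, Prod.smul_snd, smul_eq_mul]; ring⟩ c

theorem convex_le_linear_prod (a b c : ℝ) :
    Convex ℝ {p : ℝ × ℝ | c ≤ a * p.1 + b * p.2} :=
  convex_halfSpace_ge
    ⟨fun x y => by simp only [Prod.fst_add, Prod.snd_add]; ring,
      fun t x => by simp only [Prod.smul_fst, Prod.smul_snd, smul_eq_mul]; ring⟩ c

/-- A lattice point of `{fib (n + 1)}²` whose slope lies in `(1, 2]` consists of two consecutive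
Fibonacci numbers. -/
theorem exists_consecutive_fib {m n : ℕ} (h1 : Nat.fib (m + 1) < Nat.fib (n + 1))
    (h2 : Nat.fib (n + 1) ≤ 2 * Nat.fib (m + 1)) :
    ∃ l, Nat.fib (m + 1) = Nat.fib (l + 2) ∧ Nat.fib (n + 1) = Nat.fib (l + 3) := by
  obtain ⟨l, hl⟩ : ∃ l, Nat.fib (m + 1) = Nat.fib (l + 2) := by
    rcases m with _ | m
    · exact ⟨0, by simp⟩
    · exact ⟨m, rfl⟩
  refine ⟨l, hl, ?_⟩
  rw [hl] at h1 h2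
  have hlo : l + 2 < n + 1 := by
    by_contra h
    exact absurd (Nat.fib_mono (not_lt.mp h)) (not_le.mpr h1)
  have hhi : n + 1 < l + 4 := by
    by_contra h
    have h4 := Nat.fib_mono (not_lt.mp h)
    have e4 : Nat.fib (l + 4) = Nat.fib (l + 2) + Nat.fib (l + 3) := Nat.fib_add_two
    have e3 : Nat.fib (l + 3) = Nat.fib (l + 1) + Nat.fib (l + 2) := Nat.fib_add_two
    have := Nat.fib_pos.mpr (Nat.succ_pos l)
    simp only [Nat.succ_eq_add_one] at this
    omega
  congr 1
  omega

/-- The lattice point `(fib (2 * j + 2), fib (2 * j + 3))`; these points lie on one branch of the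
hyperbola `y ^ 2 - x * y - x ^ 2 = 1`. -/
def fibHyperbolaPoint (j : ℕ) : ℝ × ℝ :=
  (Nat.fib (2 * j + 2), Nat.fib (2 * j + 3))

theorem fibHyperbolaPoint_injective : Function.Injective fibHyperbolaPoint := by
  intro i j h
  have h' : Nat.fib (2 * i + 2) = Nat.fib (2 * j + 2) := by
    exact Nat.cast_injective (R := ℝ) (congrArg Prod.fst h)
  have := Nat.fib_add_two_strictMono.injective h'
  omega

open Real in
theorem strictConvexPos_fibHyperbolaPoint (s : Set ℕ) :
    StrictConvexPos (fibHyperbolaPoint '' s) := by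
  rintro _ ⟨i, -, rfl⟩ hmem
  set t : ℝ := goldenRatio ^ (2 * i + 2) with ht
  set w : ℝ := goldenConj ^ (2 * i + 2) with hw
  have key : ∀ j, (-(goldenRatio * t + goldenConj * w)) * (fibHyperbolaPoint j).1
      + (t + w) * (fibHyperbolaPoint j).2
      = t * goldenConj ^ (2 * j + 2) + w * goldenRatio ^ (2 * j + 2) := by
    intro j
    rw [← fib_succ_sub_goldenRatio_mul_fib, ← fib_succ_sub_goldenConj_mul_fib]
    simp only [fibHyperbolaPoint]
    ring
  have hprod : ∀ j : ℕ, goldenRatio ^ (2 * j + 2) * goldenConj ^ (2 * j + 2) = 1 := by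
    intro j
    rw [← mul_pow, goldenRatio_mul_goldenConj]
    exact Even.neg_one_pow ⟨j + 1, by ring⟩
  have hsub : fibHyperbolaPoint '' s \ {fibHyperbolaPoint i} ⊆
      {p : ℝ × ℝ | 2 < (-(goldenRatio * t + goldenConj * w)) * p.1 + (t + w) * p.2} := by
    rintro _ ⟨⟨j, -, rfl⟩, hne⟩
    have hij : j ≠ i := fun h => hne (by rw [h]; rfl)
    rw [Set.mem_ofPred_eq, key]
    set a : ℝ := goldenRatio ^ (2 * j + 2)
    set b : ℝ := goldenConj ^ (2 * j + 2)
    have hab : a * b = 1 := hprod j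
    have htw : t * w = 1 := hprod i
    have hbt : (t * b) * (w * a) = 1 := by linear_combination t * w * hab + htw
    have ha : 0 < a := pow_pos goldenRatio_pos _
    have ht0 : 0 < t := pow_pos goldenRatio_pos _
    have hb : 0 < b := by by_contra h; nlinarith
    have hne' : t ≠ a := fun h => hij (by
      have := pow_right_injective₀ goldenRatio_pos one_lt_goldenRatio.ne' h
      omega)
    have hx : 0 < t * b := mul_pos ht0 hb
    have hw0 : 0 < w * a := by by_contra h; nlinarith
    have hxy : t * b ≠ w * a := by
      intro h
      have h1 : t * b = 1 := by nlinarith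
      exact hne' (by linear_combination a * h1 - t * hab)
    have := sq_pos_of_ne_zero (sub_ne_zero.mpr hxy)
    nlinarith
  have h := convexHull_min hsub (convex_lt_linear_prod _ _ _) hmem
  rw [Set.mem_ofPred_eq, key] at h
  have := hprod i
  rw [← ht, ← hw] at this h
  linarith

open Real in
theorem exists_eq_fibHyperbolaPoint {k m n : ℕ}
    (h : ((Nat.fib (m + 1) : ℝ), (Nat.fib (n + 1) : ℝ)) ∈
      convexHull ℝ (fibHyperbolaPoint '' Set.Iio k)) :
    ∃ j < k, ((Nat.fib (m + 1) : ℝ), (Nat.fib (n + 1) : ℝ)) = fibHyperbolaPoint j := by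
  have hslope := convexHull_min (t := {p : ℝ × ℝ | 0 < (-goldenRatio) * p.1 + 1 * p.2}) (by
    rintro _ ⟨j, -, rfl⟩
    have h1 := fib_succ_sub_goldenRatio_mul_fib (2 * j + 2)
    have h2 : 0 < goldenConj ^ (2 * j + 2) :=
      Even.pow_pos ⟨j + 1, by ring⟩ goldenConj_ne_zero
    simp only [Set.mem_ofPred_eq, fibHyperbolaPoint]
    linarith) (convex_lt_linear_prod _ _ _) h
  have hdouble := convexHull_min (t := {p : ℝ × ℝ | 0 ≤ 2 * p.1 + (-1) * p.2}) (by
    rintro _ ⟨j, -, rfl⟩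
    have h1 : Nat.fib (2 * j + 3) = Nat.fib (2 * j + 1) + Nat.fib (2 * j + 2) := Nat.fib_add_two
    have h2 : Nat.fib (2 * j + 1) ≤ Nat.fib (2 * j + 2) := Nat.fib_le_fib_succ
    have h3 : (Nat.fib (2 * j + 3) : ℝ) ≤ 2 * Nat.fib (2 * j + 2) := by
      exact_mod_cast (by omega : Nat.fib (2 * j + 3) ≤ 2 * Nat.fib (2 * j + 2))
    simp only [Set.mem_ofPred_eq, fibHyperbolaPoint]
    linarith) (convex_le_linear_prod _ _ _) h
  have hbound := convexHull_min
    (t := {p : ℝ × ℝ | -(Nat.fib (2 * k) : ℝ) ≤ (-1) * p.1 + 0 * p.2}) (by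
    rintro _ ⟨j, hj, rfl⟩
    have hj' : j < k := hj
    have h1 : (Nat.fib (2 * j + 2) : ℝ) ≤ Nat.fib (2 * k) := by
      exact_mod_cast Nat.fib_mono (by omega)
    simp only [Set.mem_ofPred_eq, fibHyperbolaPoint]
    linarith) (convex_le_linear_prod _ _ _) h
  simp only [Set.mem_ofPred_eq] at hslope hdouble hbound
  have hpos : (0 : ℝ) < Nat.fib (m + 1) := by exact_mod_cast Nat.fib_pos.mpr (Nat.succ_pos m)
  obtain ⟨l, hm, hn⟩ := exists_consecutive_fib (m := m) (n := n)
    (by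
      have : (Nat.fib (m + 1) : ℝ) < Nat.fib (n + 1) := by
        nlinarith [one_lt_goldenRatio]
      exact_mod_cast this)
    (by
      have : (Nat.fib (n + 1) : ℝ) ≤ 2 * Nat.fib (m + 1) := by linarith
      exact_mod_cast this)
  rw [hm, hn] at hslope
  rw [hm] at hbound
  have heven : Even l := by
    by_contra hodd
    have h1 := fib_succ_sub_goldenRatio_mul_fib (l + 2)
    have h2 : goldenConj ^ (l + 2) < 0 :=
      Odd.pow_neg ((Nat.not_even_iff_odd.mp hodd).add_even even_two) goldenConj_neg
    linarith
  obtain ⟨j, rfl⟩ := heven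
  have hle : Nat.fib (j + j + 2) ≤ Nat.fib (2 * k) := by
    have : (Nat.fib (j + j + 2) : ℝ) ≤ Nat.fib (2 * k) := by linarith
    exact_mod_cast this
  refine ⟨j, ?_, ?_⟩
  · by_contra hjk
    have h1 : Nat.fib (2 * k) < Nat.fib (j + j + 2) := by
      rcases k with _ | k
      · simp
      · exact Nat.fib_add_two_strictMono (a := 2 * k) (b := j + j) (by omega)
    omega
  · rw [hm, hn, fibHyperbolaPoint, two_mul]

theorem fibonacci_lattice_infinite_helly (F : ℕ → ℝ)
    (h0 : F 0 = 1) (h1 : F 1 = 1) (hrec : ∀ n : ℕ, F (n + 2) = F (n + 1) + F n)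
    (k : ℕ) (hk : 0 < k) :
    ∃ X : Set (ℝ × ℝ), X.Finite ∧ k ≤ X.ncard ∧
      IsEmptyPolygonIn {p : ℝ × ℝ | ∃ m n : ℕ, p = (F m, F n)} X := by
  have hF : ∀ n, F n = Nat.fib (n + 1) ∧ F (n + 1) = Nat.fib (n + 2) := by
    intro n
    induction n with
    | zero => simp [h0, h1]
    | succ n ih =>
      refine ⟨ih.2, ?_⟩
      rw [hrec, ih.1, ih.2, Nat.fib_add_two (n := n + 1)]
      push_cast
      ring
  have hsub : fibHyperbolaPoint '' Set.Iio k ⊆ {p : ℝ × ℝ | ∃ m n : ℕ, p = (F m, F n)} := by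
    rintro _ ⟨j, -, rfl⟩
    exact ⟨2 * j + 1, 2 * j + 2, by rw [(hF _).1, (hF _).1]; rfl⟩
  refine ⟨fibHyperbolaPoint '' Set.Iio k, (Set.finite_Iio k).image _, ?_, hsub,
    strictConvexPos_fibHyperbolaPoint _, ?_⟩
  · rw [Set.ncard_image_of_injective _ fibHyperbolaPoint_injective, ← Finset.coe_Iio,
      Set.ncard_coe_finset, Nat.card_Iio]
  · refine Set.Subset.antisymm ?_ fun p hp => ⟨subset_convexHull ℝ _ hp, hsub hp⟩
    rintro _ ⟨hp, m, n, rfl⟩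
    rw [(hF m).1, (hF n).1] at hp ⊢
    obtain ⟨j, hj, h⟩ := exists_eq_fibHyperbolaPoint hp
    exact ⟨j, hj, h.symm⟩
end

section
/- Let (F_n) be the Fibonacci numbers with F_0 = F_1 = 1 and F_{n+2} = F_{n+1} + F_n. For every positive integer k, the points (F_{i+2}, F_i) ∈ ℝ² for odd i ∈ {1, 3, …, 2k+1} are in strictly convex position; equivalently, for every odd i ≥ 1, (F_i − F_{i−2})/(F_{i+2} − F_i) > (F_{i+2} − F_i)/(F_{i+4} − F_{i+2}). -/
/-- Every second Fibonacci number satisfies a two-term recurrence. -/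
lemma fib_add_four {F : ℤ → ℝ} (hrec : ∀ n : ℤ, F (n + 2) = F (n + 1) + F n) (n : ℤ) :
    F (n + 4) = 3 * F (n + 2) - F n := by
  have a := hrec n
  have b := hrec (n + 1)
  have c := hrec (n + 2)
  rw [show n + 1 + 2 = n + 3 by ring, show n + 1 + 1 = n + 2 by ring] at b
  rw [show n + 2 + 2 = n + 4 by ring, show n + 2 + 1 = n + 3 by ring] at c
  linarith

/-- The branch of the hyperbola `x² - 3xy + y² = 1` in the region `0 < y`, `3y < 2x`. -/
def hyperbolaBranch : Set (ℝ × ℝ) :=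
  {p | p.1 ^ 2 - 3 * p.1 * p.2 + p.2 ^ 2 = 1 ∧ 0 < p.2 ∧ 3 * p.2 < 2 * p.1}

lemma fib_mem_hyperbolaBranch {F : ℤ → ℝ} (h0 : F 0 = 1) (h1 : F 1 = 1)
    (hrec : ∀ n : ℤ, F (n + 2) = F (n + 1) + F n) {i : ℤ} (hi : Odd i) (hi1 : 1 ≤ i) :
    (F (i + 2), F i) ∈ hyperbolaBranch := by
  have key : ∀ m : ℕ, (F (2 * (m : ℤ) + 1 + 2), F (2 * (m : ℤ) + 1)) ∈ hyperbolaBranch := by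
    intro m
    induction m with
    | zero =>
      have a := hrec 0
      have b := hrec 1
      norm_num [h0, h1] at a b
      norm_num [hyperbolaBranch, h1, b, a]
    | succ m ih =>
      have h := fib_add_four hrec (2 * (m : ℤ) + 1)
      obtain ⟨hq, hy, hx⟩ := ih
      rw [show 2 * ((m + 1 : ℕ) : ℤ) + 1 = 2 * (m : ℤ) + 1 + 2 by push_cast; ring, add_assoc,
        show (2 : ℤ) + 2 = 4 by norm_num, h]
      refine ⟨?_, ?_, ?_⟩ <;> dsimp only at * <;> nlinarith
  obtain ⟨m, rfl⟩ := hi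
  lift m to ℕ using by omega
  exact key m

/-- Reverse Cauchy–Schwarz: every other point of the branch lies strictly on one side of the
tangent line at a given point of the branch. -/
lemma hyperbolaBranch_tangent_lt {p q : ℝ × ℝ} (hp : p ∈ hyperbolaBranch)
    (hq : q ∈ hyperbolaBranch) (hne : q ≠ p) :
    2 < (2 * p.1 - 3 * p.2) * q.1 + (2 * p.2 - 3 * p.1) * q.2 := by
  obtain ⟨x, y⟩ := p
  obtain ⟨x', y'⟩ := q
  obtain ⟨h, hy, hx⟩ := hp
  obtain ⟨h', hy', hx'⟩ := hq
  dsimp only at *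
  have hyy : y' ≠ y := by
    rintro rfl
    have : (x' - x) * (x' + x - 3 * y') = 0 := by linarith
    rcases mul_eq_zero.mp this with h | h
    · exact hne (by rw [sub_eq_zero.mp h])
    · linarith
  have hpos : 0 < (y' - y) ^ 2 := by
    have := sub_ne_zero.mpr hyy
    positivity
  have hu : (2 * x - 3 * y) ^ 2 = 4 + 5 * y ^ 2 := by linarith
  have hu' : (2 * x' - 3 * y') ^ 2 = 4 + 5 * y' ^ 2 := by linarith
  have hlt : 4 + 5 * (y * y') < (2 * x - 3 * y) * (2 * x' - 3 * y') := by
    refine lt_of_pow_lt_pow_left₀ 2 (mul_nonneg (by linarith) (by linarith)) ?_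
    rw [mul_pow, hu, hu']
    linarith
  linarith

lemma strictConvexPos_of_subset_hyperbolaBranch {X : Set (ℝ × ℝ)} (hX : X ⊆ hyperbolaBranch) :
    StrictConvexPos X := by
  intro p hp hmem
  let f : ℝ × ℝ →ₗ[ℝ] ℝ := (2 * p.1 - 3 * p.2) • LinearMap.fst ℝ ℝ ℝ +
    (2 * p.2 - 3 * p.1) • LinearMap.snd ℝ ℝ ℝ
  have hsub : X \ {p} ⊆ {q | 2 < f q} := fun q hq =>
    hyperbolaBranch_tangent_lt (hX hp) (hX hq.1) hq.2
  have hlt : 2 < (2 * p.1 - 3 * p.2) * p.1 + (2 * p.2 - 3 * p.1) * p.2 :=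
    convexHull_min hsub (convex_halfSpace_gt f.isLinear 2) hmem
  have := (hX hp).1
  linarith

theorem fibonacci_points_convex_position (F : ℤ → ℝ)
    (h0 : F 0 = 1) (h1 : F 1 = 1) (hrec : ∀ n : ℤ, F (n + 2) = F (n + 1) + F n) :
    (∀ k : ℕ, 0 < k →
      StrictConvexPos
        {p : ℝ × ℝ | ∃ i : ℤ, Odd i ∧ 1 ≤ i ∧ i ≤ 2 * (k : ℤ) + 1 ∧ p = (F (i + 2), F i)}) ∧
    (∀ i : ℤ, Odd i → 1 ≤ i →
      (F i - F (i - 2)) / (F (i + 2) - F i) > (F (i + 2) - F i) / (F (i + 4) - F (i + 2))) := by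
  refine ⟨fun k _ => strictConvexPos_of_subset_hyperbolaBranch ?_, fun i hi hi1 => ?_⟩
  · rintro _ ⟨i, hi, hi1, -, rfl⟩
    exact fib_mem_hyperbolaBranch h0 h1 hrec hi hi1
  · obtain ⟨hq, hy, hx⟩ := fib_mem_hyperbolaBranch h0 h1 hrec hi hi1
    dsimp only at *
    have hprev := fib_add_four hrec (i - 2)
    rw [sub_add_cancel, show i - 2 + 4 = i + 2 by ring] at hprev
    rw [fib_add_four hrec i, gt_iff_lt, div_lt_div_iff₀ (by linarith) (by linarith),
      show F (i - 2) = 3 * F i - F (i + 2) by linarith]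
    linarith
end

section
/- Let (F_n) be the Fibonacci numbers with F_0 = F_1 = 1 and F_{n+2} = F_{n+1} + F_n, and let φ = (1+√5)/2. Then for every odd integer i ≥ 1, F_i < F_{i+2}/φ² < F_i + 1/2, while for every even integer i ≥ 0, F_{i+2}/φ² < F_i. -/
open Real in
/-- A sequence with `F 0 = F 1 = 1` satisfying the Fibonacci recurrence deviates from the
geometric growth rate `φ` by exactly a power of the conjugate `ψ`. -/
theorem fib_succ_sub_goldenRatio_mul (F : ℕ → ℝ)
    (h0 : F 0 = 1) (h1 : F 1 = 1) (hrec : ∀ n : ℕ, F (n + 2) = F (n + 1) + F n) (n : ℕ) :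
    F (n + 1) - goldenRatio * F n = goldenConj ^ (n + 1) := by
  induction n with
  | zero =>
    rw [zero_add, h0, h1, pow_one, mul_one]
    linarith [goldenRatio_add_goldenConj]
  | succ n ih =>
    rw [pow_succ, ← ih, hrec]
    linear_combination F n * goldenRatio_mul_goldenConj -
      F (n + 1) * goldenRatio_add_goldenConj

open Real in
/-- The deviation of `F (n + 2)` from `φ ^ 2 * F n` is the same power of `ψ`. -/
theorem fib_add_two_eq_goldenRatio_sq_mul_add (F : ℕ → ℝ)
    (h0 : F 0 = 1) (h1 : F 1 = 1) (hrec : ∀ n : ℕ, F (n + 2) = F (n + 1) + F n) (n : ℕ) :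
    F (n + 2) = goldenRatio ^ 2 * F n + goldenConj ^ (n + 1) := by
  rw [← fib_succ_sub_goldenRatio_mul F h0 h1 hrec, hrec, goldenRatio_sq]
  ring

theorem fibonacci_near_line (F : ℕ → ℝ)
    (h0 : F 0 = 1) (h1 : F 1 = 1) (hrec : ∀ n : ℕ, F (n + 2) = F (n + 1) + F n)
    (φ : ℝ) (hφ : φ = (1 + Real.sqrt 5) / 2) :
    (∀ i : ℕ, Odd i → F i < F (i + 2) / φ ^ 2 ∧ F (i + 2) / φ ^ 2 < F i + 1 / 2) ∧
    (∀ i : ℕ, Even i → F (i + 2) / φ ^ 2 < F i) := by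
  obtain rfl : φ = Real.goldenRatio := hφ
  have hpos : 0 < Real.goldenRatio ^ 2 := pow_pos Real.goldenRatio_pos 2
  have key := fib_add_two_eq_goldenRatio_sq_mul_add F h0 h1 hrec
  refine ⟨fun i hi => ?_, fun i hi => ?_⟩
  · have hψ : 0 < Real.goldenConj ^ (i + 1) :=
      hi.add_one.pow_pos Real.goldenConj_neg.ne
    have hψ_le : Real.goldenConj ^ (i + 1) ≤ 1 := by
      rw [← hi.add_one.pow_abs]
      exact pow_le_one₀ (abs_nonneg _)
        (abs_le.2 ⟨Real.neg_one_lt_goldenConj.le, Real.goldenConj_neg.le.trans zero_le_one⟩)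
    rw [lt_div_iff₀ hpos, div_lt_iff₀ hpos, key]
    constructor
    · linarith
    · linarith [Real.goldenRatio_sq, Real.one_lt_goldenRatio]
  · have hψ : Real.goldenConj ^ (i + 1) < 0 := hi.add_one.pow_neg Real.goldenConj_neg
    rw [div_lt_iff₀ hpos, key]
    linarith
end

section
/- Let α > 1 be real, let p, q be positive integers, and let β = α^{p/q}. If N is a positive integer such that every finite subset of L(α^p) in strictly convex position whose convex hull meets L(α^p) only in that subset has at most N elements, then every finite subset X of L(α,β) in strictly convex position with conv(X) ∩ L(α,β) = X has at most pqN + 1 elements. In particular h(L(α,β)) ≤ pq·h(α^p) + 1. -/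
/-- The exponential lattice `L(α,β) = {α^n : n ∈ ℕ₀} × {β^n : n ∈ ℕ₀}`. -/
def expLattice2 (α β : ℝ) : Set (ℝ × ℝ) :=
  {p | ∃ m n : ℕ, p = (α ^ m, β ^ n)}

/-- Empty polygons pull back along injective linear maps. -/
theorem IsEmptyPolygonIn.preimage {S T X : Set (ℝ × ℝ)} (hX : IsEmptyPolygonIn S X)
    (f : ℝ × ℝ →ₗ[ℝ] ℝ × ℝ) (hf : Function.Injective f) (hT : Set.MapsTo f T S) :
    IsEmptyPolygonIn T (T ∩ f ⁻¹' X) := by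
  obtain ⟨-, hconv, hempty⟩ := hX
  have key : ∀ {A B : Set (ℝ × ℝ)} {x : ℝ × ℝ}, Set.MapsTo f A B → x ∈ convexHull ℝ A →
      f x ∈ convexHull ℝ B := fun {A B x} hAB hx =>
    convexHull_mono hAB.image_subset (f.image_convexHull A ▸ Set.mem_image_of_mem f hx)
  refine ⟨Set.inter_subset_left, fun x hx hmem => ?_, Set.Subset.antisymm ?_ ?_⟩
  · exact hconv (f x) hx.2 (key (fun y hy => ⟨hy.1.2, fun h => hy.2 (hf h)⟩) hmem)
  · rintro x ⟨hx, hxT⟩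
    have hfx : f x ∈ convexHull ℝ X ∩ S := ⟨key (fun y hy => hy.2) hx, hT hxT⟩
    exact ⟨hxT, hempty ▸ hfx⟩
  · exact fun x hx => ⟨subset_convexHull ℝ _ hx, hx.1⟩

theorem helly_upper_bound_rational_log (α : ℝ) (hα : 1 < α) (p q : ℕ)
    (hp : 0 < p) (hq : 0 < q) (β : ℝ) (hβ : β = α ^ ((p : ℝ) / (q : ℝ)))
    (N : ℕ) (hN0 : 0 < N)
    (hN : ∀ Y : Set (ℝ × ℝ), Y.Finite → IsEmptyPolygonIn (expLattice (α ^ p)) Y →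
      Y.ncard ≤ N)
    (X : Set (ℝ × ℝ)) (hfin : X.Finite) (hX : IsEmptyPolygonIn (expLattice2 α β) X) :
    X.ncard ≤ p * q * N + 1 := by
  have hα0 : 0 < α := one_pos.trans hα
  have hβ0 : 0 < β := hβ ▸ Real.rpow_pos_of_pos hα0 _
  have hpow : β ^ q = α ^ p := by
    rw [hβ, ← Real.rpow_natCast, ← Real.rpow_mul hα0.le,
      div_mul_cancel₀ _ (Nat.cast_ne_zero.2 hq.ne'), Real.rpow_natCast]
  let f : ℕ × ℕ → (ℝ × ℝ →ₗ[ℝ] ℝ × ℝ) := fun i => LinearMap.mulLeft ℝ (α ^ i.1, β ^ i.2)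
  have hf : ∀ i, Function.Injective (f i) := by
    rintro i ⟨x, y⟩ ⟨x', y'⟩ h
    simpa [f, hα0.ne', hβ0.ne'] using h
  have hmaps : ∀ i, Set.MapsTo (f i) (expLattice (α ^ p)) (expLattice2 α β) := by
    rintro i _ ⟨m, n, rfl⟩
    refine ⟨i.1 + p * m, i.2 + q * n, ?_⟩
    simp [f, pow_add, pow_mul, hpow]
  let Y : ℕ × ℕ → Set (ℝ × ℝ) := fun i => expLattice (α ^ p) ∩ f i ⁻¹' X
  have hYfin : ∀ i, (Y i).Finite := fun i =>
    (hfin.preimage (hf i).injOn).subset Set.inter_subset_right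
  have hcover : X ⊆ ⋃ i ∈ Finset.range p ×ˢ Finset.range q, f i '' Y i := by
    intro x hx
    obtain ⟨m, n, rfl⟩ := hX.1 hx
    have hval : f (m % p, n % q) ((α ^ p) ^ (m / p), (α ^ p) ^ (n / q)) = (α ^ m, β ^ n) := by
      simp only [f, LinearMap.mulLeft_apply, Prod.mk_mul_mk]
      nth_rewrite 2 [← hpow]
      rw [← pow_mul, ← pow_mul, ← pow_add, ← pow_add, Nat.mod_add_div, Nat.mod_add_div]
    refine Set.mem_biUnion (x := (m % p, n % q)) ?_ ⟨_, ⟨⟨m / p, n / q, rfl⟩, ?_⟩, hval⟩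
    · simp [Nat.mod_lt, hp, hq]
    · rwa [Set.mem_preimage, hval]
  calc X.ncard ≤ (⋃ i ∈ Finset.range p ×ˢ Finset.range q, f i '' Y i).ncard :=
        Set.ncard_le_ncard hcover
          (Set.Finite.biUnion (Finset.finite_toSet _) fun i _ => (hYfin i).image _)
    _ ≤ ∑ i ∈ Finset.range p ×ˢ Finset.range q, (f i '' Y i).ncard :=
        Finset.set_ncard_biUnion_le _ _
    _ ≤ ∑ _i ∈ Finset.range p ×ˢ Finset.range q, N := Finset.sum_le_sum fun i _ =>
        (Set.ncard_image_le (hYfin i)).trans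
          (hN _ (hYfin i) (hX.preimage (f i) (hf i) (hmaps i)))
    _ = p * q * N := by simp
    _ ≤ p * q * N + 1 := Nat.le_succ _
end

section
/- Let α > 1 be real, let p, q be positive integers, and let β = α^{p/q}. Then h(L(α,β)) ≥ ⌊(1/(pq))·⌊√(1/(α^{1/q} − 1))⌋⌋; that is, there is a subset X of L(α,β) of that cardinality which is in strictly convex position and satisfies conv(X) ∩ L(α,β) = X. -/
theorem notMem_convexHull_of_mul_le {A : Set (ℝ × ℝ)} {C : ℝ}
    (hA : ∀ a ∈ A, 0 < a.1 ∧ 0 < a.2 ∧ a.1 * a.2 = C) {z : ℝ × ℝ} (h1 : 0 < z.1) (h2 : 0 < z.2)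
    (hz : z.1 * z.2 ≤ C) (hzA : z ∉ A) : z ∉ convexHull ℝ A := by
  have hconv : Convex ℝ {a : ℝ × ℝ | 2 * (z.1 * z.2) < z.2 * a.1 + z.1 * a.2} :=
    convex_halfSpace_gt (f := fun a : ℝ × ℝ => z.2 * a.1 + z.1 * a.2)
      ⟨fun a b => by simp only [Prod.fst_add, Prod.snd_add]; ring,
        fun c a => by simp only [Prod.smul_fst, Prod.smul_snd, smul_eq_mul]; ring⟩ _
  have hsub : A ⊆ {a : ℝ × ℝ | 2 * (z.1 * z.2) < z.2 * a.1 + z.1 * a.2} := by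
    intro a ha
    obtain ⟨ha1, ha2, haC⟩ := hA a ha
    simp only [Set.mem_ofPred_eq]
    by_contra! hle
    have hzz : 0 < z.1 * z.2 := mul_pos h1 h2
    have hpos : 0 < z.2 * a.1 + z.1 * a.2 := by positivity
    have hsq : (z.2 * a.1 + z.1 * a.2) ^ 2 ≤ (2 * (z.1 * z.2)) ^ 2 := by gcongr
    have hprod : (z.1 * z.2) * (z.1 * z.2) ≤ (z.1 * z.2) * (a.1 * a.2) := by
      rw [haC]; gcongr
    have hdiff : z.2 * a.1 - z.1 * a.2 = 0 := by
      have : (z.2 * a.1 - z.1 * a.2) ^ 2 ≤ 0 := by nlinarith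
      exact pow_eq_zero_iff two_ne_zero |>.mp (le_antisymm this (sq_nonneg _))
    have e1 : a.1 ≤ z.1 := le_of_mul_le_mul_left (by linarith) h2
    have e2 : a.2 ≤ z.2 := le_of_mul_le_mul_left (by linarith) h1
    have e1' : z.1 ≤ a.1 := by
      by_contra! hlt
      nlinarith [mul_lt_mul_of_pos_right hlt h2, mul_le_mul_of_nonneg_left e2 ha1.le]
    have e2' : z.2 ≤ a.2 := by
      by_contra! hlt
      nlinarith [mul_lt_mul_of_pos_left hlt h1, mul_le_mul_of_nonneg_right e1 ha2.le]
    exact hzA (Prod.ext (le_antisymm e1' e1) (le_antisymm e2' e2) ▸ ha)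
  intro hmem
  have := convexHull_min hsub hconv hmem
  simp only [Set.mem_ofPred_eq] at this
  linarith

theorem add_le_of_mem_convexHull {A : Set (ℝ × ℝ)} {c : ℝ} (hA : ∀ a ∈ A, a.1 + a.2 ≤ c)
    {z : ℝ × ℝ} (hz : z ∈ convexHull ℝ A) : z.1 + z.2 ≤ c := by
  have hconv : Convex ℝ {a : ℝ × ℝ | a.1 + a.2 ≤ c} :=
    convex_halfSpace_le (f := fun a : ℝ × ℝ => a.1 + a.2)
      ⟨fun a b => by simp only [Prod.fst_add, Prod.snd_add]; ring,
        fun c a => by simp only [Prod.smul_fst, Prod.smul_snd, smul_eq_mul]; ring⟩ _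
  exact convexHull_min hA hconv hz

theorem one_add_pow_le_one_add_mul {d : ℝ} (hd : 0 ≤ d) (N : ℕ) :
    (1 + d) ^ N ≤ 1 + N * d * (1 + d) ^ N := by
  induction N with
  | zero => simp
  | succ n ih =>
    have h : 0 ≤ (1 + d) ^ n := by positivity
    have hn : (0 : ℝ) ≤ n := n.cast_nonneg
    rw [pow_succ]
    push_cast
    nlinarith [mul_nonneg (mul_nonneg (by positivity : 0 ≤ ((n : ℝ) + 1)) (mul_nonneg hd hd)) h]

theorem sq_one_add_pow_lt {g : ℝ} (hg : 1 < g) {N : ℕ} (hN : ((N : ℝ) + 1) ^ 2 * (g - 1) ≤ 1) :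
    (1 + g ^ N) ^ 2 < 4 * g ^ (N + 1) := by
  obtain ⟨d, rfl⟩ : ∃ d, g = 1 + d := ⟨g - 1, by ring⟩
  have hd : 0 < d := by linarith
  have hN0 : (0 : ℝ) ≤ N := N.cast_nonneg
  have h1 : (1 : ℝ) ≤ (1 + d) ^ N := one_le_pow₀ hg.le
  have hle := one_add_pow_le_one_add_mul hd.le N
  rw [pow_succ (1 + d) N]
  set G := (1 + d) ^ N
  rw [add_sub_cancel_left] at hN
  have hNd : N * d ≤ 1 / 4 := by nlinarith [mul_nonneg (sq_nonneg ((N : ℝ) - 1)) hd.le]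
  have hNNd : (N : ℝ) ^ 2 * d ≤ 1 := by nlinarith [mul_nonneg hN0 hd.le]
  have hG : G ≤ 4 / 3 := by nlinarith [mul_le_mul_of_nonneg_right hNd (by linarith : 0 ≤ G)]
  have hsq : (G - 1) ^ 2 ≤ (N * d * G) ^ 2 := by
    gcongr
    · linarith
  have hbound : (N * d * G) ^ 2 ≤ d * G ^ 2 := by
    have := mul_le_mul_of_nonneg_right hNNd (by positivity : 0 ≤ d * G ^ 2)
    nlinarith
  have : d * G ^ 2 < 4 * d * G := by
    have := mul_pos hd (by linarith : 0 < G)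
    nlinarith
  nlinarith

theorem isEmptyPolygonIn_hyperbola {g : ℝ} (hg : 1 < g) {N : ℕ}
    (hN : ((N : ℝ) + 1) ^ 2 * (g - 1) ≤ 1) {S X : Set (ℝ × ℝ)}
    (hS : S ⊆ expLattice g) (hXS : X ⊆ S)
    (hX : ∀ x ∈ X, 1 ≤ x.1 ∧ 1 ≤ x.2 ∧ x.1 * x.2 = g ^ N) : IsEmptyPolygonIn S X := by
  have hXpos : ∀ x ∈ X, 0 < x.1 ∧ 0 < x.2 ∧ x.1 * x.2 = g ^ N := fun x hx =>
    ⟨by linarith [(hX x hx).1], by linarith [(hX x hx).2.1], (hX x hx).2.2⟩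
  refine ⟨hXS, fun x hx => ?_, Set.Subset.antisymm ?_ fun x hx => ⟨subset_convexHull ℝ X hx, hXS hx⟩⟩
  · obtain ⟨h1, h2, h3⟩ := hXpos x hx
    exact notMem_convexHull_of_mul_le (fun a ha => hXpos a ha.1) h1 h2 h3.le fun h => h.2 rfl
  · rintro z ⟨hz, hzS⟩
    obtain ⟨m, n, rfl⟩ := hS hzS
    by_contra hzX
    have hg0 : 0 < g := by linarith
    rcases le_or_gt (m + n) N with hmn | hmn
    · refine notMem_convexHull_of_mul_le hXpos (pow_pos hg0 m) (pow_pos hg0 n) ?_ hzX hz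
      rw [← pow_add]
      exact pow_le_pow_right₀ hg.le hmn
    · have hsum := add_le_of_mem_convexHull (c := 1 + g ^ N) (fun a ha => by
        obtain ⟨h1, h2, h3⟩ := hX a ha
        nlinarith [mul_nonneg (sub_nonneg.2 h1) (sub_nonneg.2 h2)]) hz
      have hpow : g ^ (N + 1) ≤ g ^ m * g ^ n := by
        rw [← pow_add]
        exact pow_le_pow_right₀ hg.le hmn
      have hlt := sq_one_add_pow_lt hg hN
      have hm : 0 < g ^ m := pow_pos hg0 m
      have hn : 0 < g ^ n := pow_pos hg0 n
      have hsq : (g ^ m + g ^ n) ^ 2 ≤ (1 + g ^ N) ^ 2 := by gcongr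
      nlinarith [sq_nonneg (g ^ m - g ^ n)]

theorem exists_isEmptyPolygonIn_ncard {g : ℝ} (hg : 1 < g) {p q : ℕ} (hp : 0 < p) (hq : 0 < q)
    {K : ℕ} (hK : ((p * q * K : ℕ) : ℝ) ^ 2 * (g - 1) ≤ 1) :
    ∃ X : Set (ℝ × ℝ), X.Finite ∧ IsEmptyPolygonIn (expLattice2 (g ^ q) (g ^ p)) X ∧
      X.ncard = K := by
  rcases K with _ | M
  · exact ⟨∅, Set.finite_empty, ⟨Set.empty_subset _, fun x hx => hx.elim, by simp⟩, by simp⟩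
  let f : ℕ → ℝ × ℝ := fun i => ((g ^ q) ^ (p * i), (g ^ p) ^ (q * (M - i)))
  have hf : Function.Injective f := fun i j hij => by
    have h := congrArg Prod.fst hij
    have := pow_right_injective₀ (zero_lt_one.trans (one_lt_pow₀ hg hq.ne'))
      (one_lt_pow₀ hg hq.ne').ne' h
    exact Nat.eq_of_mul_eq_mul_left hp this
  refine ⟨f '' (Finset.range (M + 1) : Finset ℕ), (Finset.finite_toSet _).image f, ?_, ?_⟩
  · refine isEmptyPolygonIn_hyperbola (N := p * q * M) hg ?_ ?_ ?_ ?_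
    · refine le_trans (mul_le_mul_of_nonneg_right ?_ (by linarith)) hK
      have : p * q * M + 1 ≤ p * q * (M + 1) := by
        rw [mul_add_one]
        exact Nat.add_le_add_left (Nat.mul_pos hp hq) _
      gcongr
      exact_mod_cast this
    · rintro _ ⟨m, n, rfl⟩
      exact ⟨q * m, p * n, by simp only [pow_mul]⟩
    · rintro _ ⟨i, -, rfl⟩
      exact ⟨_, _, rfl⟩
    · rintro _ ⟨i, hi, rfl⟩
      have hi' : i ≤ M := by simpa [Nat.lt_succ_iff] using hi
      refine ⟨one_le_pow₀ (one_le_pow₀ hg.le), one_le_pow₀ (one_le_pow₀ hg.le), ?_⟩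
      obtain ⟨j, rfl⟩ := Nat.exists_eq_add_of_le hi'
      simp only [f, ← pow_mul, ← pow_add, Nat.add_sub_cancel_left]
      congr 1
      ring
  · rw [Set.ncard_image_of_injective _ hf, Set.ncard_coe_finset, Finset.card_range]

theorem helly_lower_bound_rational_log (α : ℝ) (hα : 1 < α) (p q : ℕ)
    (hp : 0 < p) (hq : 0 < q) (β : ℝ) (hβ : β = α ^ ((p : ℝ) / (q : ℝ))) :
    ∃ X : Set (ℝ × ℝ), X.Finite ∧ IsEmptyPolygonIn (expLattice2 α β) X ∧
      (X.ncard : ℤ) =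
        ⌊((⌊Real.sqrt (1 / (α ^ ((1 : ℝ) / (q : ℝ)) - 1))⌋ : ℝ) / ((p : ℝ) * (q : ℝ)))⌋ := by
  have hα0 : 0 ≤ α := by linarith
  have hq' : (0 : ℝ) < q := Nat.cast_pos.2 hq
  have hp' : (0 : ℝ) < p := Nat.cast_pos.2 hp
  set g : ℝ := α ^ ((1 : ℝ) / (q : ℝ)) with hgdef
  have hg : 1 < g := Real.one_lt_rpow hα (by positivity)
  have hgq : g ^ q = α := by
    rw [hgdef, ← Real.rpow_mul_natCast hα0, one_div_mul_cancel hq'.ne', Real.rpow_one]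
  have hgp : g ^ p = β := by
    rw [hβ, hgdef, ← Real.rpow_mul_natCast hα0, one_div_mul_eq_div]
  set s := Real.sqrt (1 / (g - 1)) with hs
  have hs0 : 0 ≤ s := Real.sqrt_nonneg _
  have hk0 : (0 : ℝ) ≤ ⌊s⌋ := by exact_mod_cast Int.floor_nonneg.2 hs0
  obtain ⟨K, hK⟩ := Int.eq_ofNat_of_zero_le
    (Int.floor_nonneg.2 (by positivity : 0 ≤ (⌊s⌋ : ℝ) / ((p : ℝ) * q)))
  have hKle : ((p * q * K : ℕ) : ℝ) ≤ s := by
    have h1 : (K : ℝ) ≤ (⌊s⌋ : ℝ) / ((p : ℝ) * q) := by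
      have := Int.floor_le ((⌊s⌋ : ℝ) / ((p : ℝ) * q))
      rw [hK] at this
      exact_mod_cast this
    rw [le_div_iff₀ (by positivity)] at h1
    push_cast
    linarith [Int.floor_le s]
  have hgpos : 0 < g - 1 := by linarith
  obtain ⟨X, hfin, hX, hcard⟩ := exists_isEmptyPolygonIn_ncard hg hp hq (K := K) (by
    calc ((p * q * K : ℕ) : ℝ) ^ 2 * (g - 1) ≤ s ^ 2 * (g - 1) := by gcongr
      _ = 1 := by rw [hs, Real.sq_sqrt (by positivity), one_div_mul_cancel hgpos.ne'])
  rw [hgq, hgp] at hX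
  exact ⟨X, hfin, hX, by rw [hcard, hK]⟩
end

section
/- Let α > 1 and β > 1 be real numbers such that log_α(β) is irrational, i.e., there are no positive integers p, q with β^q = α^p. Then h(L(α,β)) = ∞: for every positive integer k there exists a finite subset X ⊆ L(α,β) with |X| ≥ k that is in strictly convex position and satisfies conv(X) ∩ L(α,β) = X. -/
/-- The slope of the `i`-th edge of the polygonal chain with vertices `(x i, y i)`. -/
noncomputable def chainSlope (x y : ℕ → ℝ) (i : ℕ) : ℝ :=
  (y (i + 1) - y i) / (x (i + 1) - x i)

section Chain

variable {x y : ℕ → ℝ}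

theorem chainSlope_mul (hx : StrictMono x) (i : ℕ) :
    chainSlope x y i * (x (i + 1) - x i) = y (i + 1) - y i :=
  div_mul_cancel₀ _ (sub_pos.2 (hx i.lt_succ_self)).ne'

theorem chain_lt_of_slope_lt (hx : StrictMono x) (hs : StrictAnti (chainSlope x y)) {t : ℝ} {i j : ℕ}
    (ht : chainSlope x y i < t) (hij : i < j) : y j - t * x j < y i - t * x i := by
  have step (n : ℕ) (hn : chainSlope x y n < t) :
      y (n + 1) - t * x (n + 1) < y n - t * x n := by
    nlinarith [chainSlope_mul (y := y) hx n, hx n.lt_succ_self]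
  induction j, hij using Nat.le_induction with
  | base => exact step i ht
  | succ j hij ih => exact (step j ((hs hij).trans ht)).trans ih

theorem chain_lt_of_lt_slope (hx : StrictMono x) (hs : StrictAnti (chainSlope x y)) {t : ℝ} {i j : ℕ}
    (ht : t < chainSlope x y i) (hij : j ≤ i) : y j - t * x j < y (i + 1) - t * x (i + 1) := by
  have step (n : ℕ) (hn : t < chainSlope x y n) :
      y n - t * x n < y (n + 1) - t * x (n + 1) := by
    nlinarith [chainSlope_mul (y := y) hx n, hx n.lt_succ_self]
  induction i, hij using Nat.le_induction with
  | base => exact step j ht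
  | succ i hij ih => exact (ih (ht.trans (hs i.lt_succ_self))).trans (step _ ht)

/-- A concave chain has a strict supporting line at each inner vertex. -/
theorem exists_strict_support (hx : StrictMono x) (hs : StrictAnti (chainSlope x y)) (i : ℕ) :
    ∃ t : ℝ, ∀ j ≠ i + 1, y j - t * x j < y (i + 1) - t * x (i + 1) := by
  obtain ⟨t, h₁, h₂⟩ := exists_between (hs i.lt_succ_self)
  refine ⟨t, fun j hj => ?_⟩
  rcases lt_or_gt_of_ne hj with h | h
  · exact chain_lt_of_lt_slope hx hs h₂ (Nat.le_of_lt_succ h)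
  · exact chain_lt_of_slope_lt hx hs h₁ h

/-- A concave chain lies below the line through any of its edges. -/
theorem chain_le_edge (hx : StrictMono x) (hs : StrictAnti (chainSlope x y)) (i j : ℕ) :
    y j - chainSlope x y i * x j ≤ y i - chainSlope x y i * x i := by
  have hedge := chainSlope_mul (y := y) hx i
  rcases lt_trichotomy j i with h | rfl | h
  · obtain ⟨i, rfl⟩ : ∃ i', i = i' + 1 := ⟨i - 1, by omega⟩
    exact (chain_lt_of_lt_slope hx hs (hs i.lt_succ_self) (Nat.le_of_lt_succ h)).le
  · exact le_rfl
  · rcases (show i + 1 ≤ j from h).eq_or_lt with rfl | h'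
    · linarith
    · linarith [chain_lt_of_slope_lt hx hs (hs i.lt_succ_self) h']

end Chain

theorem convexHull_lt_of_forall_lt {X : Set (ℝ × ℝ)} {a b c : ℝ}
    (h : ∀ p ∈ X, a * p.1 + b * p.2 < c) : ∀ p ∈ convexHull ℝ X, a * p.1 + b * p.2 < c := by
  have hconv : Convex ℝ {p : ℝ × ℝ | a * p.1 + b * p.2 < c} := by
    refine convex_halfSpace_lt ⟨fun p q => ?_, fun r p => ?_⟩ c
    · simp only [Prod.fst_add, Prod.snd_add]; ring
    · simp only [Prod.smul_fst, Prod.smul_snd, smul_eq_mul]; ring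
  exact fun p hp => convexHull_min h hconv hp

theorem convexHull_le_of_forall_le {X : Set (ℝ × ℝ)} {a b c : ℝ}
    (h : ∀ p ∈ X, a * p.1 + b * p.2 ≤ c) : ∀ p ∈ convexHull ℝ X, a * p.1 + b * p.2 ≤ c := by
  have hconv : Convex ℝ {p : ℝ × ℝ | a * p.1 + b * p.2 ≤ c} := by
    refine convex_halfSpace_le ⟨fun p q => ?_, fun r p => ?_⟩ c
    · simp only [Prod.fst_add, Prod.snd_add]; ring
    · simp only [Prod.smul_fst, Prod.smul_snd, smul_eq_mul]; ring
  exact fun p hp => convexHull_min h hconv hp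

/-- `L(α,β)` contains an empty convex polygon with at least `k` vertices. -/
def HasEmptyPolygon (α β : ℝ) (k : ℕ) : Prop :=
  ∃ X : Set (ℝ × ℝ), X.Finite ∧ k ≤ X.ncard ∧ IsEmptyPolygonIn (expLattice2 α β) X

theorem HasEmptyPolygon.swap {α β : ℝ} {k : ℕ} (h : HasEmptyPolygon α β k) :
    HasEmptyPolygon β α k := by
  obtain ⟨X, hfin, hcard, hsub, hpos, hhull⟩ := h
  have hinj : Function.Injective (Prod.swap : ℝ × ℝ → ℝ × ℝ) := Prod.swap_injective
  have himage (Y : Set (ℝ × ℝ)) :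
      convexHull ℝ (Prod.swap '' Y) = Prod.swap '' convexHull ℝ Y :=
    ((LinearEquiv.prodComm ℝ ℝ ℝ).toLinearMap.image_convexHull Y).symm
  have hlattice : expLattice2 β α = Prod.swap '' expLattice2 α β := by
    ext ⟨a, b⟩
    simp only [expLattice2, Set.mem_ofPred_eq, Set.mem_image, Prod.exists, Prod.mk.injEq,
      Prod.swap_prod_mk]
    constructor
    · rintro ⟨m, n, rfl, rfl⟩
      exact ⟨_, _, ⟨n, m, rfl, rfl⟩, rfl, rfl⟩
    · rintro ⟨_, _, ⟨n, m, rfl, rfl⟩, rfl, rfl⟩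
      exact ⟨m, n, rfl, rfl⟩
  refine ⟨Prod.swap '' X, hfin.image _, by rwa [Set.ncard_image_of_injective _ hinj], ?_, ?_, ?_⟩
  · rw [hlattice]
    exact Set.image_mono hsub
  · rintro _ ⟨p, hp, rfl⟩
    rw [← Set.image_singleton, ← Set.image_sdiff hinj, himage, hinj.mem_set_image]
    exact hpos p hp
  · rw [hlattice, himage, ← Set.image_inter hinj, hhull]

/-- A concave chain of lattice points above the diagonal, each of which minimizes the ratio `y / x`
among all lattice points above the diagonal up to the next abscissa, bounds an empty polygon. -/
theorem hasEmptyPolygon_of_chain {α β : ℝ} (hα : 1 < α) {P Q : ℕ → ℕ} (N : ℕ)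
    (hP : StrictMono P)
    (hslope : StrictAnti (chainSlope (fun i => α ^ P i) (fun i => β ^ Q i)))
    (hratio : ∀ i, β ^ Q (i + 1) * α ^ P i < β ^ Q i * α ^ P (i + 1))
    (hdiag : ∀ i ≤ N, α ^ P i < β ^ Q i)
    (hmin : ∀ i ≤ N, ∀ m n : ℕ, m < P (i + 1) → α ^ m < β ^ n →
      β ^ Q i * α ^ m ≤ β ^ n * α ^ P i) :
    HasEmptyPolygon α β N := by
  have hx : StrictMono fun i => α ^ P i := (pow_right_strictMono₀ hα).comp hP
  set v : ℕ → ℝ × ℝ := fun i => (α ^ P i, β ^ Q i) with hv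
  have hvinj : Function.Injective v := fun i j h => hx.injective (congrArg Prod.fst h)
  refine ⟨v '' Set.Icc 1 N, (Set.finite_Icc 1 N).image v, ?_, ?_, ?_, ?_⟩
  · rw [Set.ncard_image_of_injective _ hvinj, ← Finset.coe_Icc, Set.ncard_coe_finset]
    simp
  · rintro _ ⟨i, -, rfl⟩
    exact ⟨P i, Q i, rfl⟩
  · rintro _ ⟨i, hi, rfl⟩ hmem
    obtain ⟨i, rfl⟩ : ∃ i', i = i' + 1 := ⟨i - 1, by have := hi.1; omega⟩
    obtain ⟨t, ht⟩ := exists_strict_support hx hslope i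
    have := convexHull_lt_of_forall_lt (a := -t) (b := 1) (c := β ^ Q (i + 1) - t * α ^ P (i + 1))
      (by
        rintro _ ⟨⟨j, -, rfl⟩, hj⟩
        have := ht j (fun h => hj (by rw [h]; rfl))
        simp only [hv]
        linarith) _ hmem
    simp only [hv] at this
    linarith
  · refine Set.Subset.antisymm ?_ (Set.subset_inter (subset_convexHull ℝ _) ?_)
    swap
    · rintro _ ⟨i, -, rfl⟩
      exact ⟨P i, Q i, rfl⟩
    rintro _ ⟨hw, m, n, rfl⟩
    have hlow : P 1 ≤ m := by
      have := convexHull_le_of_forall_le (a := -1) (b := 0) (c := -α ^ P 1)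
        (by
          rintro _ ⟨j, hj, rfl⟩
          have := hx.monotone hj.1
          simp only [hv]
          linarith) _ hw
      refine (pow_le_pow_iff_right₀ hα).1 ?_
      simp only at this
      linarith
    have hhigh : m ≤ P N := by
      have := convexHull_le_of_forall_le (a := 1) (b := 0) (c := α ^ P N)
        (by
          rintro _ ⟨j, hj, rfl⟩
          have := hx.monotone hj.2
          simp only [hv]
          linarith) _ hw
      refine (pow_le_pow_iff_right₀ hα).1 ?_
      simp only at this
      linarith
    have habove : α ^ m < β ^ n := by
      have := convexHull_lt_of_forall_lt (a := 1) (b := -1) (c := 0)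
        (by
          rintro _ ⟨j, hj, rfl⟩
          have := hdiag j hj.2
          simp only [hv]
          linarith) _ hw
      simp only at this
      linarith
    have hN : 1 ≤ N := by
      by_contra h
      obtain rfl : N = 0 := by omega
      simp at hw
    set i := Nat.findGreatest (fun j => P j ≤ m) N with hi
    have hi1 : 1 ≤ i := Nat.le_findGreatest hN hlow
    have hiN : i ≤ N := Nat.findGreatest_le N
    have hPi : P i ≤ m := Nat.findGreatest_spec (P := fun j => P j ≤ m) hN hlow
    have hPi' : m < P (i + 1) := by
      rcases hiN.eq_or_lt with h | h
      · rw [h]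
        exact hhigh.trans_lt (hP N.lt_succ_self)
      · exact not_le.1 (Nat.findGreatest_is_greatest (P := fun j => P j ≤ m) i.lt_succ_self h)
    have hrec := hmin i hiN m n hPi' habove
    have hedge := convexHull_le_of_forall_le
      (a := -chainSlope (fun i => α ^ P i) (fun i => β ^ Q i) i) (b := 1)
      (c := β ^ Q i - chainSlope (fun i => α ^ P i) (fun i => β ^ Q i) i * α ^ P i)
      (by
        rintro _ ⟨j, -, rfl⟩
        have := chain_le_edge hx hslope i j
        simp only [hv]
        linarith) _ hw
    have hs := chainSlope_mul (y := fun i => β ^ Q i) hx i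
    set s := chainSlope (fun i => α ^ P i) (fun i => β ^ Q i) i
    have hxi : 0 < α ^ P i := by positivity
    have hlt := hx i.lt_succ_self
    have hr := hratio i
    simp only at hs hlt hedge
    have hsr : s * α ^ P i < β ^ Q i := by
      by_contra! h
      nlinarith
    have hm : m = P i := by
      by_contra hne
      have : α ^ P i < α ^ m := pow_lt_pow_right₀ hα (lt_of_le_of_ne hPi (Ne.symm hne))
      nlinarith
    rw [hm] at hrec hedge ⊢
    have hn : β ^ n = β ^ Q i := by
      refine le_antisymm (by linarith) ?_
      exact le_of_mul_le_mul_right hrec hxi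
    exact ⟨i, ⟨hi1, hiN⟩, by simp only [hv, hn]⟩

/-- The exponent vectors `(pu, qu)` and `(pl, ql)` generate `ℤ²` and the corresponding lattice
points lie strictly above and strictly below the diagonal, respectively. -/
structure Straddles (α β : ℝ) (pu qu pl ql : ℕ) : Prop where
  pu_pos : 0 < pu
  ql_pos : 0 < ql
  upper : α ^ pu < β ^ qu
  lower : β ^ ql < α ^ pl
  span : ∀ m n : ℕ, ∃ a b : ℤ, (m : ℤ) = a * pu + b * pl ∧ (n : ℤ) = a * qu + b * ql

namespace Straddles

variable {α β : ℝ} {pu qu pl ql : ℕ}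

theorem swap (h : Straddles α β pu qu pl ql) : Straddles β α ql pl qu pu where
  pu_pos := h.ql_pos
  ql_pos := h.pu_pos
  upper := h.lower
  lower := h.upper
  span m n := by
    obtain ⟨a, b, h₁, h₂⟩ := h.span n m
    exact ⟨b, a, by rw [h₂]; ring, by rw [h₁]; ring⟩

theorem pl_pos (hβ : 1 < β) (h : Straddles α β pu qu pl ql) : 0 < pl := by
  rcases Nat.eq_zero_or_pos pl with h0 | h0
  · have := h.lower
    rw [h0, pow_zero] at this
    exact absurd this (one_le_pow₀ hβ.le).not_gt
  · exact h0

theorem add_upper (h : Straddles α β pu qu pl ql) (hadd : α ^ (pu + pl) < β ^ (qu + ql)) :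
    Straddles α β (pu + pl) (qu + ql) pl ql where
  pu_pos := Nat.add_pos_left h.pu_pos _
  ql_pos := h.ql_pos
  upper := hadd
  lower := h.lower
  span m n := by
    obtain ⟨a, b, h₁, h₂⟩ := h.span m n
    exact ⟨a, b - a, by rw [h₁]; push_cast; ring, by rw [h₂]; push_cast; ring⟩

theorem add_lower (h : Straddles α β pu qu pl ql) (hadd : β ^ (ql + qu) < α ^ (pl + pu)) :
    Straddles α β pu qu (pl + pu) (ql + qu) :=
  (h.swap.add_upper hadd).swap

/-- The iterated version of `add_upper`. -/
theorem add_mul_upper (h : Straddles α β pu qu pl ql) (j : ℕ)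
    (hj : α ^ (pu + j * pl) < β ^ (qu + j * ql)) :
    Straddles α β (pu + j * pl) (qu + j * ql) pl ql where
  pu_pos := Nat.add_pos_left h.pu_pos _
  ql_pos := h.ql_pos
  upper := hj
  lower := h.lower
  span m n := by
    obtain ⟨a, b, h₁, h₂⟩ := h.span m n
    exact ⟨a, b - j * a, by rw [h₁]; push_cast; ring, by rw [h₂]; push_cast; ring⟩

theorem upper_of_le (hα : 1 < α) (hβ : 1 < β) (h : Straddles α β pu qu pl ql) {i j : ℕ}
    (hij : i ≤ j) (hj : α ^ (pu + j * pl) < β ^ (qu + j * ql)) :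
    α ^ (pu + i * pl) < β ^ (qu + i * ql) := by
  obtain ⟨d, rfl⟩ := Nat.exists_eq_add_of_le hij
  by_contra! hi
  have hd : (β ^ ql) ^ d ≤ (α ^ pl) ^ d := pow_le_pow_left₀ (by positivity) h.lower.le d
  refine absurd hj (not_lt.2 ?_)
  calc β ^ (qu + (i + d) * ql) = β ^ (qu + i * ql) * (β ^ ql) ^ d := by ring
    _ ≤ α ^ (pu + i * pl) * (α ^ pl) ^ d := by gcongr
    _ = α ^ (pu + (i + d) * pl) := by ring

/-- Up to abscissa `α ^ (pu + pl)`, the upper point of a straddling pair minimizes the ratio `y / x`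
among all lattice points above the diagonal. -/
theorem ratio_le (hα : 1 < α) (hβ : 1 < β) (h : Straddles α β pu qu pl ql) {m n : ℕ}
    (hm : m < pu + pl) (hmn : α ^ m < β ^ n) : β ^ qu * α ^ m ≤ β ^ n * α ^ pu := by
  have hα0 : 0 < α := by linarith
  have hβ0 : 0 < β := by linarith
  have hlog {p q : ℕ} (hpq : α ^ p < β ^ q) : p * Real.log α < q * Real.log β := by
    rw [← Real.log_pow, ← Real.log_pow]
    exact Real.log_lt_log (by positivity) hpq
  have hu := hlog h.upper
  have hl : ql * Real.log β < pl * Real.log α := by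
    rw [← Real.log_pow, ← Real.log_pow]
    exact Real.log_lt_log (by positivity) h.lower
  have hw := hlog hmn
  obtain ⟨a, b, hma, hnb⟩ := h.span m n
  have hpl : (0 : ℤ) < pl := by exact_mod_cast h.pl_pos hβ
  have hpu : (0 : ℤ) < pu := by exact_mod_cast h.pu_pos
  have hm0 : (0 : ℤ) ≤ m := Int.natCast_nonneg m
  have hm' : (m : ℤ) < pu + pl := by exact_mod_cast hm
  have hmR : (m : ℝ) = a * pu + b * pl := by exact_mod_cast hma
  have hnR : (n : ℝ) = a * qu + b * ql := by exact_mod_cast hnb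
  have ha : 1 ≤ a := by
    by_contra! ha
    have ha0 : a ≤ 0 := by omega
    have hb : 0 ≤ b := by
      by_contra! hb
      nlinarith
    have ha0' : (a : ℝ) ≤ 0 := by exact_mod_cast ha0
    have hb' : (0 : ℝ) ≤ b := by exact_mod_cast hb
    rw [hmR, hnR] at hw
    nlinarith
  have hb : b ≤ 0 := by
    by_contra! hb
    nlinarith
  have ha' : (1 : ℝ) ≤ a := by exact_mod_cast ha
  have hb' : (b : ℝ) ≤ 0 := by exact_mod_cast hb
  rw [← Real.log_le_log_iff (by positivity) (by positivity),
    Real.log_mul (by positivity) (by positivity), Real.log_mul (by positivity) (by positivity)]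
  simp only [Real.log_pow]
  rw [hmR, hnR]
  nlinarith

end Straddles

/-- Consecutive straddling pairs, each arising by adding the lower vector to the upper one, yield an
empty polygon as soon as the slopes of the resulting chain decrease. -/
theorem hasEmptyPolygon_of_straddles {α β : ℝ} (hα : 1 < α) (hβ : 1 < β) {P Q a b : ℕ → ℕ} (N : ℕ)
    (hP : ∀ i, P (i + 1) = P i + a i) (hQ : ∀ i, Q (i + 1) = Q i + b i)
    (hlower : ∀ i, β ^ b i < α ^ a i)
    (hstr : ∀ i ≤ N, Straddles α β (P i) (Q i) (a i) (b i))
    (hslope : ∀ i, β ^ b i * (β ^ b (i + 1) - 1) * (α ^ a i - 1) <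
      α ^ a i * (β ^ b i - 1) * (α ^ a (i + 1) - 1)) :
    HasEmptyPolygon α β N := by
  have hA (i : ℕ) : 1 < α ^ a i := (one_le_pow₀ hβ.le).trans_lt (hlower i)
  have hPmono : StrictMono P := by
    refine strictMono_nat_of_lt_succ fun i => ?_
    have : a i ≠ 0 := fun h => by simpa [h] using hA i
    rw [hP]
    omega
  refine hasEmptyPolygon_of_chain hα N hPmono ?_ ?_ (fun i hi => (hstr i hi).upper) ?_
  · refine strictAnti_nat_of_succ_lt fun i => ?_
    have hx : 0 < α ^ P i := by positivity
    have hy : 0 < β ^ Q i := by positivity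
    have h₁ := hA i
    have h₂ := hA (i + 1)
    have hfst : chainSlope (fun i => α ^ P i) (fun i => β ^ Q i) i =
        β ^ Q i * (β ^ b i - 1) / (α ^ P i * (α ^ a i - 1)) := by
      simp only [chainSlope, hP, hQ, pow_add]
      ring_nf
    have hsnd : chainSlope (fun i => α ^ P i) (fun i => β ^ Q i) (i + 1) =
        β ^ Q i * (β ^ b i * (β ^ b (i + 1) - 1)) /
          (α ^ P i * (α ^ a i * (α ^ a (i + 1) - 1))) := by
      simp only [chainSlope, hP, hQ, pow_add]
      ring_nf
    rw [hfst, hsnd, mul_div_mul_comm, mul_div_mul_comm (β ^ Q i) (β ^ b i - 1)]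
    refine mul_lt_mul_of_pos_left ?_ (by positivity)
    rw [div_lt_div_iff₀ (mul_pos (by positivity) (by linarith)) (by linarith)]
    linarith [hslope i]
  · intro i
    rw [hP, hQ, pow_add, pow_add]
    have := mul_lt_mul_of_pos_left (hlower i) (show 0 < β ^ Q i * α ^ P i by positivity)
    linarith
  · intro i hi m n hm
    rw [hP] at hm
    exact (hstr i hi).ratio_le hα hβ hm

theorem Straddles.hasEmptyPolygon_of_upper {α β : ℝ} (hα : 1 < α) (hβ : 1 < β) {pu qu pl ql N : ℕ}
    (h : Straddles α β pu qu pl ql) (hN : α ^ (pu + N * pl) < β ^ (qu + N * ql)) :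
    HasEmptyPolygon α β N := by
  have hB : 1 < β ^ ql := one_lt_pow₀ hβ h.ql_pos.ne'
  refine hasEmptyPolygon_of_straddles hα hβ (P := fun i => pu + i * pl) (Q := fun i => qu + i * ql)
    (a := fun _ => pl) (b := fun _ => ql) N (fun i => by ring) (fun i => by ring)
    (fun _ => h.lower) (fun i hi => h.add_mul_upper i (h.upper_of_le hα hβ hi hN)) fun _ => ?_
  have hl := h.lower
  have := mul_lt_mul_of_pos_left hl
    (mul_pos (show 0 < β ^ ql - 1 by linarith) (show 0 < α ^ pl - 1 by linarith))
  linarith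

/-- In the absence of an empty `k`-gon, fewer than `k` additions of the upper vector to the lower
one lead to a straddling pair whose sum lies above the diagonal. -/
theorem Straddles.exists_add_upper {α β : ℝ} (hα : 1 < α) (hβ : 1 < β)
    (hirr : ∀ p q : ℕ, 0 < p → 0 < q → β ^ q ≠ α ^ p) {k : ℕ} (hno : ¬ HasEmptyPolygon α β k)
    {pu qu pl ql : ℕ} (h : Straddles α β pu qu pl ql) :
    ∃ j < k, Straddles α β pu qu (pl + j * pu) (ql + j * qu) ∧
      α ^ (pu + (pl + j * pu)) < β ^ (qu + (ql + j * qu)) := by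
  classical
  have hk : ∃ i, ¬ β ^ (ql + i * qu) < α ^ (pl + i * pu) :=
    ⟨k, fun hlt => hno (h.swap.hasEmptyPolygon_of_upper hβ hα hlt).swap⟩
  have hspec := Nat.find_spec hk
  have hle : Nat.find hk ≤ k :=
    Nat.find_min' hk fun hlt => hno (h.swap.hasEmptyPolygon_of_upper hβ hα hlt).swap
  have hne : Nat.find hk ≠ 0 := fun h0 =>
    (Nat.find_eq_zero hk).1 h0 (by simpa using h.lower)
  obtain ⟨j, hj⟩ := Nat.exists_eq_succ_of_ne_zero hne
  have hlt : β ^ (ql + j * qu) < α ^ (pl + j * pu) :=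
    not_not.1 (Nat.find_min hk (by omega))
  refine ⟨j, by omega, (h.swap.add_mul_upper j hlt).swap, ?_⟩
  rw [hj, not_lt] at hspec
  have hp : pu + (pl + j * pu) = pl + (j + 1) * pu := by ring
  have hq : qu + (ql + j * qu) = ql + (j + 1) * qu := by ring
  rw [hp, hq]
  exact lt_of_le_of_ne hspec
    (hirr _ _ (Nat.add_pos_left (h.pl_pos hβ) _) (Nat.add_pos_left h.ql_pos _)).symm

/-- Without an empty `k`-gon there are straddling pairs with arbitrarily large lower vectors whose
sum lies above the diagonal. -/
theorem Straddles.exists_large {α β : ℝ} (hα : 1 < α) (hβ : 1 < β)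
    (hirr : ∀ p q : ℕ, 0 < p → 0 < q → β ^ q ≠ α ^ p) {k : ℕ} (hno : ¬ HasEmptyPolygon α β k)
    {pu qu pl ql : ℕ} (h : Straddles α β pu qu pl ql) (C : ℕ) :
    ∃ pu qu pl ql : ℕ, Straddles α β pu qu pl ql ∧ α ^ (pu + pl) < β ^ (qu + ql) ∧ C ≤ ql := by
  have key : ∃ pu qu pl ql : ℕ, Straddles α β pu qu pl ql ∧ C ≤ ql := by
    induction C with
    | zero => exact ⟨_, _, _, _, h, Nat.zero_le _⟩
    | succ C ih =>
      obtain ⟨pu, qu, pl, ql, h, hC⟩ := ih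
      obtain ⟨j, -, hj, hsum⟩ := h.swap.exists_add_upper hβ hα
        (fun p q hp hq => (hirr q p hq hp).symm) (fun hpoly => hno hpoly.swap)
      have hnew := hj.swap.add_lower hsum
      have := hj.pl_pos hα
      exact ⟨_, _, _, _, hnew, by omega⟩
  obtain ⟨pu, qu, pl, ql, h, hC⟩ := key
  obtain ⟨j, -, hj, hsum⟩ := h.exists_add_upper hα hβ hirr hno
  exact ⟨_, _, _, _, hj, hsum, hC.trans (Nat.le_add_right _ _)⟩

/-- If `B / A` is at most `n` times as far from `1` as `B' / A'` and `B` is large, then the slopes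
of consecutive edges decrease. -/
theorem slope_lt_of_ratio {A B A' B' n : ℝ} (hB : n + 1 < B) (hn : 0 ≤ n) (hAB : B < A)
    (hB' : 0 < B') (hAB' : B' < A') (hA' : 1 < A') (h : 1 - B / A ≤ n * (1 - B' / A')) :
    B * (B' - 1) * (A - 1) < A * (B - 1) * (A' - 1) := by
  obtain ⟨r, rfl⟩ : ∃ r, B = r * A := ⟨B / A, (div_mul_cancel₀ _ (by linarith)).symm⟩
  obtain ⟨r', rfl⟩ : ∃ r', B' = r' * A' := ⟨B' / A', (div_mul_cancel₀ _ (by linarith)).symm⟩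
  have hA : 1 < A := by linarith
  rw [mul_div_cancel_right₀ _ (by linarith), mul_div_cancel_right₀ _ (by linarith)] at h
  have hr : r < 1 := by
    by_contra! hr
    nlinarith
  have hr0 : 0 < r := by
    by_contra! hr
    nlinarith
  have hr' : r' < 1 := by
    by_contra! hr
    nlinarith
  have h₁ : r * A * (r' * A' - 1) * (A - 1) ≤ A * (A' - 1) * (r * r' * (A - 1)) := by
    have : 0 ≤ r * A * (A - 1) * (1 - r') :=
      mul_nonneg (mul_nonneg (by positivity) (by linarith)) (by linarith)
    linarith
  have h₂ : r * r' * (A - 1) < r * A - 1 := by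
    have h₃ : (n + 1) * (1 - r') < r * A * (1 - r') :=
      mul_lt_mul_of_pos_right hB (by linarith)
    have h₄ : r * (1 - r') ≤ 1 - r' := mul_le_of_le_one_left (by linarith) hr.le
    linarith
  have h₅ := mul_lt_mul_of_pos_left h₂ (show 0 < A * (A' - 1) from
    mul_pos (by linarith) (by linarith))
  linarith

/-- If two consecutive runs of additions have length at most `k`, then the distances of the
corresponding ratios from `1` differ at most by a factor `k ^ 2`. -/
theorem one_sub_ratio_le {A B A' B' X Y : ℝ} {k : ℕ} (hA : 0 < A) (hA' : 0 < A')
    (hB' : 0 < B') (hY : 0 < Y) (h₁ : A * X ^ k ≤ B * Y ^ k)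
    (h₂ : Y * B' ^ k ≤ X * A' ^ k) : 1 - B / A ≤ (k ^ 2 : ℕ) * (1 - B' / A') := by
  have hXY : (B' / A') ^ k ≤ X / Y := by
    rw [div_pow, div_le_div_iff₀ (by positivity) hY]
    linarith
  have hAB : (X / Y) ^ k ≤ B / A := by
    rw [div_pow, div_le_div_iff₀ (by positivity) hA]
    linarith
  have hpow : (B' / A') ^ k ^ 2 ≤ B / A := by
    rw [sq, pow_mul]
    exact (pow_le_pow_left₀ (by positivity) hXY k).trans hAB
  have hpos : 0 < B' / A' := by positivity
  have hbern := one_add_mul_le_pow (show (-2 : ℝ) ≤ B' / A' - 1 by linarith) (k ^ 2)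
  rw [add_sub_cancel] at hbern
  linarith

/-- A straddling pair with large lower vector and sum above the diagonal can be continued such that
the slopes of the chain decrease. -/
theorem Straddles.exists_next {α β : ℝ} (hα : 1 < α) (hβ : 1 < β)
    (hirr : ∀ p q : ℕ, 0 < p → 0 < q → β ^ q ≠ α ^ p) {k : ℕ} (hno : ¬ HasEmptyPolygon α β k)
    {pu qu pl ql : ℕ} (h : Straddles α β pu qu pl ql) (hsum : α ^ (pu + pl) < β ^ (qu + ql))
    (hlarge : ((k ^ 2 : ℕ) : ℝ) + 1 < β ^ ql) :
    ∃ pl' ql' : ℕ, Straddles α β (pu + pl) (qu + ql) pl' ql' ∧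
      α ^ (pu + pl + pl') < β ^ (qu + ql + ql') ∧ ql ≤ ql' ∧
      β ^ ql * (β ^ ql' - 1) * (α ^ pl - 1) < α ^ pl * (β ^ ql - 1) * (α ^ pl' - 1) := by
  obtain ⟨j, hjk, hj, hsum'⟩ := (h.add_upper hsum).exists_add_upper hα hβ hirr hno
  refine ⟨_, _, hj, hsum', Nat.le_add_right _ _, ?_⟩
  have hend := not_lt.1 fun hlt => hno (hj.hasEmptyPolygon_of_upper hα hβ hlt)
  have hnot := not_lt.1 fun hlt =>
    absurd ((h.add_upper hsum).swap.upper_of_le hβ hα (Nat.succ_le_of_lt hjk) hlt) (by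
      refine not_lt.2 (le_of_eq_of_le ?_ (hsum'.le.trans_eq ?_)) <;> congr 1 <;>
        rw [Nat.succ_eq_add_one] <;> ring)
  refine slope_lt_of_ratio hlarge (Nat.cast_nonneg _) h.lower (by positivity) hj.lower
    (one_lt_pow₀ hα (hj.pl_pos hβ).ne') ?_
  refine one_sub_ratio_le (X := α ^ (pu + pl)) (Y := β ^ (qu + ql)) (by positivity)
    (by positivity) (by positivity) (by positivity) ?_ ?_
  · rwa [← pow_mul', ← pow_add, ← pow_mul', ← pow_add]
  · rwa [← pow_mul', ← pow_add, ← pow_mul', ← pow_add]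

theorem Straddles.hasEmptyPolygon {α β : ℝ} (hα : 1 < α) (hβ : 1 < β)
    (hirr : ∀ p q : ℕ, 0 < p → 0 < q → β ^ q ≠ α ^ p) {pu qu pl ql : ℕ}
    (h : Straddles α β pu qu pl ql) (k : ℕ) : HasEmptyPolygon α β k := by
  by_contra hno
  obtain ⟨C, hC⟩ := pow_unbounded_of_one_lt (((k ^ 2 : ℕ) : ℝ) + 1) hβ
  let Admissible (s : (ℕ × ℕ) × ℕ × ℕ) : Prop :=
    Straddles α β s.1.1 s.1.2 s.2.1 s.2.2 ∧
      α ^ (s.1.1 + s.2.1) < β ^ (s.1.2 + s.2.2) ∧ C ≤ s.2.2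
  have hnext (s : {s // Admissible s}) : ∃ s' : {s // Admissible s},
      s'.1.1 = s.1.1 + s.1.2 ∧
      β ^ s.1.2.2 * (β ^ s'.1.2.2 - 1) * (α ^ s.1.2.1 - 1) <
        α ^ s.1.2.1 * (β ^ s.1.2.2 - 1) * (α ^ s'.1.2.1 - 1) := by
    obtain ⟨⟨⟨pu, qu⟩, pl, ql⟩, hs, hsum, hCs⟩ := s
    obtain ⟨pl', ql', hs', hsum', hle, hslope⟩ := hs.exists_next hα hβ hirr hno hsum
      (hC.trans_le (pow_le_pow_right₀ hβ.le hCs))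
    exact ⟨⟨((pu + pl, qu + ql), pl', ql'), hs', hsum', hCs.trans hle⟩, rfl, hslope⟩
  choose next hadd hslope using hnext
  obtain ⟨pu, qu, pl, ql, h₀⟩ := h.exists_large hα hβ hirr hno C
  let s : ℕ → {s // Admissible s} := fun i => next^[i] ⟨((pu, qu), pl, ql), h₀⟩
  have hs (i : ℕ) : s (i + 1) = next (s i) := Function.iterate_succ_apply' _ _ _
  refine hno (hasEmptyPolygon_of_straddles hα hβ (P := fun i => (s i).1.1.1)
    (Q := fun i => (s i).1.1.2) (a := fun i => (s i).1.2.1) (b := fun i => (s i).1.2.2) k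
    (fun i => ?_) (fun i => ?_) (fun i => (s i).2.1.lower) (fun i _ => (s i).2.1) fun i => ?_)
  · simp only [hs, hadd, Prod.fst_add]
  · simp only [hs, hadd, Prod.snd_add]
  · simp only [hs]
    exact hslope (s i)

theorem hasEmptyPolygon_of_lt {α β : ℝ} (hα : 1 < α) (hαβ : α < β)
    (hirr : ∀ p q : ℕ, 0 < p → 0 < q → β ^ q ≠ α ^ p) (k : ℕ) : HasEmptyPolygon α β k := by
  have hβ := hα.trans hαβ
  obtain ⟨n, hn, hn'⟩ := exists_nat_pow_near hβ.le hα
  have hn0 : 0 < n := by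
    rcases Nat.eq_zero_or_pos n with rfl | h
    · rw [zero_add, pow_one] at hn'
      exact absurd hαβ hn'.not_gt
    · exact h
  have hne : α ^ n ≠ β := fun h => hirr n 1 hn0 one_pos (by rw [pow_one, h])
  have hstart : Straddles α β n 1 (n + 1) 1 :=
    { pu_pos := hn0
      ql_pos := one_pos
      upper := by rw [pow_one]; exact lt_of_le_of_ne hn hne
      lower := by rwa [pow_one]
      span := fun m c => ⟨c - (m - c * n), m - c * n, by push_cast; ring, by push_cast; ring⟩ }
  exact hstart.hasEmptyPolygon hα hβ hirr k

theorem helly_infinite_of_irrational_log (α β : ℝ) (hα : 1 < α) (hβ : 1 < β)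
    (hirr : ¬ ∃ p q : ℕ, 0 < p ∧ 0 < q ∧ β ^ q = α ^ p)
    (k : ℕ) (hk : 0 < k) :
    ∃ X : Set (ℝ × ℝ), X.Finite ∧ k ≤ X.ncard ∧
      IsEmptyPolygonIn (expLattice2 α β) X := by
  have hirr' (p q : ℕ) (hp : 0 < p) (hq : 0 < q) : β ^ q ≠ α ^ p :=
    fun h => hirr ⟨p, q, hp, hq, h⟩
  rcases lt_trichotomy α β with h | rfl | h
  · exact hasEmptyPolygon_of_lt hα h hirr' k
  · exact absurd rfl (hirr' 1 1 one_pos one_pos)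
  · exact (hasEmptyPolygon_of_lt hβ h (fun p q hp hq => (hirr' q p hq hp).symm) k).swap
end

section
/- Let α, β > 1 be real numbers, let p', q' be nonnegative integers and p, q positive integers with β^q > α^p. Then for every nonnegative integer i, the slope of the segment between the points (α^{p'+(i+1)p}, β^{q'+(i+1)q}) and (α^{p'+(i+2)p}, β^{q'+(i+2)q}) is strictly greater than the slope of the segment between (α^{p'+ip}, β^{q'+iq}) and (α^{p'+(i+1)p}, β^{q'+(i+1)q}); consequently, for every m ∈ ℕ the points (α^{p'+ip}, β^{q'+iq}) for i = 0, 1, …, m are in strictly convex position. -/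
/-- Points on the graph of a strictly convex function are in strictly convex position. -/
theorem StrictConvexOn.strictConvexPos {s : Set ℝ} {f : ℝ → ℝ} (hf : StrictConvexOn ℝ s f)
    {X : Set (ℝ × ℝ)} (hX : ∀ x ∈ X, x.1 ∈ s ∧ x.2 = f x.1) : StrictConvexPos X := by
  intro x hx hmem
  have hsub : X \ {x} ⊆ {y : ℝ × ℝ | (y.1 ∈ s ∧ f y.1 ≤ y.2) ∧ y ≠ x} := fun y hy =>
    ⟨⟨(hX y hy.1).1, (hX y hy.1).2.ge⟩, hy.2⟩
  refine (convexHull_min hsub ?_ hmem).2 rfl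
  have hx2 := (hX x hx).2
  rw [convex_iff_forall_pos]
  rintro ⟨u₁, u₂⟩ ⟨⟨hu, hfu⟩, hux⟩ ⟨v₁, v₂⟩ ⟨⟨hv, hfv⟩, hvx⟩ a b ha hb hab
  refine ⟨hf.convexOn.convex_epigraph ⟨hu, hfu⟩ ⟨hv, hfv⟩ ha.le hb.le hab, ?_⟩
  rintro rfl
  simp only [Prod.smul_mk, Prod.mk_add_mk, smul_eq_mul] at hx2 hux
  have hau : a * f u₁ ≤ a * u₂ := mul_le_mul_of_nonneg_left hfu ha.le
  have hbv : b * f v₁ ≤ b * v₂ := mul_le_mul_of_nonneg_left hfv hb.le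
  by_cases huv : u₁ = v₁
  · subst huv
    have h₁ : a * u₁ + b * u₁ = u₁ := by rw [← add_mul, hab, one_mul]
    have h₂ : a * f u₁ + b * f u₁ = f u₁ := by rw [← add_mul, hab, one_mul]
    rw [h₁] at hx2 hux
    have h₃ : a * u₂ = a * f u₁ := by linarith
    exact hux (Prod.ext rfl (by rw [hx2]; exact mul_left_cancel₀ ha.ne' h₃))
  · have hlt := hf.2 hu hv huv ha hb hab
    simp only [smul_eq_mul] at hlt
    linarith

/-- Two geometric progressions, the second with the larger ratio, lie on the graph of a strictly
convex function. -/
theorem exists_strictConvexOn_geometric {A B a b : ℝ} (hA : 0 < A) (hB : 0 < B) (ha : 1 < a)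
    (hab : a < b) :
    ∃ f : ℝ → ℝ, StrictConvexOn ℝ (Set.Ici 0) f ∧ ∀ i : ℕ, f (A * a ^ i) = B * b ^ i := by
  have ha₀ : 0 < a := one_pos.trans ha
  have hc : 1 < Real.logb a b := by
    rwa [Real.lt_logb_iff_rpow_lt ha (ha₀.trans hab), Real.rpow_one]
  have hAc : 0 < A ^ Real.logb a b := Real.rpow_pos_of_pos hA _
  refine ⟨fun x => B / A ^ Real.logb a b * x ^ Real.logb a b, ⟨convex_Ici 0, ?_⟩, fun i => ?_⟩
  · intro x hx y hy hxy s t hs ht hst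
    have hlt := mul_lt_mul_of_pos_left ((strictConvexOn_rpow hc).2 hx hy hxy hs ht hst)
      (div_pos hB hAc)
    simp only [smul_eq_mul] at hlt ⊢
    linarith
  · have hpow : (a ^ i) ^ Real.logb a b = b ^ i := by
      rw [← Real.rpow_natCast_mul ha₀.le, mul_comm, Real.rpow_mul_natCast ha₀.le,
        Real.rpow_logb ha₀ ha.ne' (ha₀.trans hab)]
    simp only [Real.mul_rpow hA.le (pow_pos ha₀ i).le, hpow]
    field_simp

theorem semiconvergent_points_convex (α β : ℝ) (hα : 1 < α) (hβ : 1 < β)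
    (p' q' : ℕ) (p q : ℕ) (hp : 0 < p) (hq : 0 < q) (h : α ^ p < β ^ q) :
    (∀ i : ℕ,
      (β ^ (q' + (i + 2) * q) - β ^ (q' + (i + 1) * q)) /
          (α ^ (p' + (i + 2) * p) - α ^ (p' + (i + 1) * p)) >
        (β ^ (q' + (i + 1) * q) - β ^ (q' + i * q)) /
          (α ^ (p' + (i + 1) * p) - α ^ (p' + i * p))) ∧
    (∀ m : ℕ,
      StrictConvexPos
        {pt : ℝ × ℝ | ∃ i : ℕ, i ≤ m ∧ pt = (α ^ (p' + i * p), β ^ (q' + i * q))}) := by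
  have hα₀ : 0 < α := one_pos.trans hα
  have hβ₀ : 0 < β := one_pos.trans hβ
  obtain ⟨f, hf, hfi⟩ := exists_strictConvexOn_geometric (pow_pos hα₀ p') (pow_pos hβ₀ q')
    (one_lt_pow₀ hα hp.ne') h
  replace hfi (i : ℕ) : f (α ^ (p' + i * p)) = β ^ (q' + i * q) := by
    rw [pow_add, pow_add, mul_comm i p, mul_comm i q, pow_mul, pow_mul, hfi]
  have hmem (n : ℕ) : α ^ n ∈ Set.Ici (0 : ℝ) := (pow_pos hα₀ n).le
  refine ⟨fun i => ?_, fun m => hf.strictConvexPos ?_⟩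
  · rw [← hfi, ← hfi, ← hfi]
    refine hf.slope_strict_mono_adjacent (hmem _) (hmem _) (pow_lt_pow_right₀ hα ?_)
      (pow_lt_pow_right₀ hα ?_) <;> gcongr <;> simp
  · rintro _ ⟨i, -, rfl⟩
    exact ⟨hmem _, (hfi i).symm⟩
end

section
/- Let α > 1 be a real number and let r be a positive integer with α^r − α^{r−1} ≥ 1 (for instance r = ⌈log_α(α/(α−1))⌉). Then for all positive integers k, ℓ, m, n, the point (α^{k+m+r}, 0) lies on or above the line through u = (α^k, α^ℓ) and v = (α^{k+m}, α^{ℓ−n}); explicitly, (α^ℓ − α^{ℓ−n})·α^{k+m+r} ≥ α^{k+ℓ+m} − α^{k+ℓ−n}. -/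
theorem point_above_line_type_I (α : ℝ) (hα : 1 < α) (r : ℤ) (hr : 0 < r)
    (hcond : α ^ r - α ^ (r - 1) ≥ 1)
    (k ℓ m n : ℤ) (hk : 0 < k) (hℓ : 0 < ℓ) (hm : 0 < m) (hn : 0 < n) :
    (α ^ ℓ - α ^ (ℓ - n)) * α ^ (k + m + r) ≥ α ^ (k + ℓ + m) - α ^ (k + ℓ - n) := by
  have hpos : 0 < α := zero_lt_one.trans hα
  have hstep : α ^ (r - n) ≤ α ^ (r - 1) := zpow_le_zpow_right₀ hα.le (by lia)
  have hone : 1 ≤ α ^ r - α ^ (r - n) := by linarith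
  have hfactor : (α ^ ℓ - α ^ (ℓ - n)) * α ^ (k + m + r) =
      α ^ (k + ℓ + m) * (α ^ r - α ^ (r - n)) := by
    simp only [sub_mul, mul_sub, ← zpow_add₀ hpos.ne']
    ring_nf
  calc α ^ (k + ℓ + m) - α ^ (k + ℓ - n) ≤ α ^ (k + ℓ + m) :=
        sub_le_self _ (zpow_pos hpos _).le
    _ ≤ α ^ (k + ℓ + m) * (α ^ r - α ^ (r - n)) :=
        le_mul_of_one_le_right (zpow_pos hpos _).le hone
    _ = (α ^ ℓ - α ^ (ℓ - n)) * α ^ (k + m + r) := hfactor.symm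
end

section
/- Let α > 1 be a real number and let s, t be positive integers with α^{−s} + α^{−t} ≤ 1. Then for all integers m, n with m ≥ s + t and n ≥ s + t, α^{−t} + α^{−s} < 1 − α^{−m−n} + α^{−t−n} + α^{−s−m}. -/
theorem type_III_inequality (α : ℝ) (hα : 1 < α) (s t : ℤ) (hs : 0 < s) (ht : 0 < t)
    (hst : α ^ (-s) + α ^ (-t) ≤ 1)
    (m n : ℤ) (hm : s + t ≤ m) (hn : s + t ≤ n) :
    α ^ (-t) + α ^ (-s) < 1 - α ^ (-m - n) + α ^ (-t - n) + α ^ (-s - m) := by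
  have hmn : α ^ (-m - n) < α ^ (-s - m) := zpow_lt_zpow_right₀ hα (by lia)
  have htn : 0 < α ^ (-t - n) := zpow_pos (by linarith) _
  linarith
end
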